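/- The binary operation ⊛^B on the set Θ^B of formal power series with coefficients in ℂ² is associative and has the series Δ'(z) = (1,0)z as a two-sided unit. -/

import Mathlib

open scoped Classical

namespace NCPB

/-- A collection of subsets of `α` is a partition: blocks are nonempty and
every element lies in exactly one block. -/
def IsPartition {α : Type*} (P : Set (Set α)) : Prop :=
  (∀ B ∈ P, B.Nonempty) ∧ ∀ a : α, ∃! B, B ∈ P ∧ a ∈ B

/-- The non-crossing condition for a collection of subsets of a linear order:
if `a < b < c < d`, `a, c` lie in a block `B` and `b, d` lie in a block `C`,
then `b ∈ B` (i.e. the blocks coincide). -/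
def IsNC {α : Type*} [LinearOrder α] (P : Set (Set α)) : Prop :=
  ∀ B ∈ P, ∀ C ∈ P, ∀ a b c d : α, a < b → b < c → c < d →
    a ∈ B → c ∈ B → b ∈ C → d ∈ C → b ∈ B

/-- A non-crossing partition of a linear order. -/
def NCPart {α : Type*} [LinearOrder α] (P : Set (Set α)) : Prop :=
  IsPartition P ∧ IsNC P

/-- The set `[±m] = {1 < 2 < ... < m < -1 < -2 < ... < -m}` is encoded as `Fin (2*m)`,
position `k < m` encoding `k+1` and position `m + j` encoding `-(j+1)`.
`negMap` is the inversion map `a ↦ -a`. -/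
def negMap (m : ℕ) (k : Fin (2*m)) : Fin (2*m) :=
  ⟨(k.val + m) % (2*m), Nat.mod_lt _ (Nat.lt_of_le_of_lt (Nat.zero_le _) k.isLt)⟩

/-- Image of a subset of `[±m]` under the inversion map, i.e. `X ↦ -X`. -/
def negSet (m : ℕ) (X : Set (Fin (2*m))) : Set (Fin (2*m)) := negMap m '' X

/-- The absolute value map `[±m] → {1,...,m}`, `±i ↦ i`. -/
def absMap (m : ℕ) (k : Fin (2*m)) : Fin m :=
  ⟨k.val % m, Nat.mod_lt _ (by have := k.isLt; omega)⟩

/-- A non-crossing partition of type B: a non-crossing partition of `[±m]`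
invariant under the inversion map. -/
def NCBPart (m : ℕ) (π : Set (Set (Fin (2*m)))) : Prop :=
  NCPart π ∧ ∀ B ∈ π, negSet m B ∈ π

/-- The collection of sets `Abs(X)`, `X` a block of `π`. -/
def absPart (m : ℕ) (π : Set (Set (Fin (2*m)))) : Set (Set (Fin m)) :=
  {F | ∃ X ∈ π, F = absMap m '' X}

/-- The embedding of `{1,...,m}` onto the odd-indexed positions of the interleaved
set `1 < 1̄ < 2 < 2̄ < ... < m < m̄` (encoded as `Fin (2*m)`): `i ↦ i` (even positions). -/
def evens (m : ℕ) (i : Fin m) : Fin (2*m) := ⟨2*i.val, by have := i.isLt; omega⟩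

/-- The embedding of the barred copy `{1̄,...,m̄}` into the interleaved set: odd positions. -/
def odds (m : ℕ) (i : Fin m) : Fin (2*m) := ⟨2*i.val+1, by have := i.isLt; omega⟩

/-- `P` refines... rather: every block of `P` is contained in a block of `Q`
(the partial order on partitions by reverse refinement: `P ≤ Q`). -/
def Refines {α : Type*} (P Q : Set (Set α)) : Prop := ∀ B ∈ P, ∃ C ∈ Q, B ⊆ C

/-- The collection `p ∪ q̄` of subsets of the interleaved set
`1 < 1̄ < 2 < 2̄ < ... < m < m̄`, with `p` living on the unbarred copy and `q` on the
barred copy. -/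
def interleave (m : ℕ) (p q : Set (Set (Fin m))) : Set (Set (Fin (2*m))) :=
  ((fun B => evens m '' B) '' p) ∪ ((fun B => odds m '' B) '' q)

/-- `q` is the Kreweras complement of `p`: `q` is the largest non-crossing partition
(in the reverse-refinement order) such that `p ∪ q̄` is a non-crossing partition of the
interleaved set `1 < 1̄ < ... < m < m̄`. -/
def IsKr (m : ℕ) (p q : Set (Set (Fin m))) : Prop :=
  NCPart q ∧ NCPart (interleave m p q) ∧
  ∀ q', NCPart q' → NCPart (interleave m p q') → Refines q' q

/-- Two sets cross: there are `a < b < c < d` with `a, c ∈ B` and `b, d ∈ C`. -/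
def Crossing {α : Type*} [LinearOrder α] (B C : Set α) : Prop :=
  ∃ a b c d : α, a < b ∧ b < c ∧ c < d ∧ a ∈ B ∧ c ∈ B ∧ b ∈ C ∧ d ∈ C

/-- Two members of a non-crossing family of pairwise disjoint sets: disjoint,
and neither crosses the other. -/
def PairNC {α : Type*} [LinearOrder α] (B C : Set α) : Prop :=
  Disjoint B C ∧ ¬ Crossing B C ∧ ¬ Crossing C B

end NCPB
namespace NCPB

/-- `X` is the chosen representative of the pair of blocks `{X, -X}`:
the least element of `X ∪ (-X)` lies in `X`. -/
def IsRep (m : ℕ) (X : Set (Fin (2*m))) : Prop :=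
  ∃ x, IsLeast (X ∪ negSet m X) x ∧ x ∈ X

/-- The first component `γ'_m` of the coefficients of the boxed convolution of type B:
a summation over `NC^A(m)` (each `p` paired with its Kreweras complement). -/
noncomputable def gammaFst (a' b' : ℕ → ℂ) (m : ℕ) : ℂ :=
  ∑ᶠ (pq : Set (Set (Fin m)) × Set (Set (Fin m)))
    (_ : NCPart pq.1 ∧ IsKr m pq.1 pq.2),
    (∏ᶠ F ∈ pq.1, a' F.ncard) * (∏ᶠ E ∈ pq.2, b' E.ncard)

/-- The second component `γ''_m` of the coefficients of the boxed convolution of type B: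
a summation over `NC^B(m)`, split according to whether `π` or `Kr(π)` has the
zero-block `Z` (the third component of the summation variable `t`). The products run
over a choice of one block out of each pair `{X, -X}` of non-zero-blocks. -/
noncomputable def gammaSnd (a' a'' b' b'' : ℕ → ℂ) (m : ℕ) : ℂ :=
  (∑ᶠ (t : (Set (Set (Fin (2*m))) × Set (Set (Fin (2*m)))) × Set (Fin (2*m)))
    (_ : NCBPart m t.1.1 ∧ IsKr (2*m) t.1.1 t.1.2 ∧ t.2 ∈ t.1.1 ∧ negSet m t.2 = t.2),
    (∏ᶠ X ∈ {X | X ∈ t.1.1 ∧ negSet m X ≠ X ∧ IsRep m X}, a' X.ncard) *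
      a'' (t.2.ncard / 2) *
      (∏ᶠ Y ∈ {Y | Y ∈ t.1.2 ∧ negSet m Y ≠ Y ∧ IsRep m Y}, b' Y.ncard))
  +
  (∑ᶠ (t : (Set (Set (Fin (2*m))) × Set (Set (Fin (2*m)))) × Set (Fin (2*m)))
    (_ : NCBPart m t.1.1 ∧ (¬ ∃ Z ∈ t.1.1, negSet m Z = Z) ∧
         IsKr (2*m) t.1.1 t.1.2 ∧ t.2 ∈ t.1.2 ∧ negSet m t.2 = t.2),
    (∏ᶠ X ∈ {X | X ∈ t.1.1 ∧ negSet m X ≠ X ∧ IsRep m X}, a' X.ncard) *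
      b'' (t.2.ncard / 2) *
      (∏ᶠ Y ∈ {Y | Y ∈ t.1.2 ∧ negSet m Y ≠ Y ∧ IsRep m Y}, b' Y.ncard))

/-- An element of `ℂ²`, regarded as an element of the algebra
`C = ℂ[x]/(x²)` (realized as the dual numbers over `ℂ`). -/
noncomputable def mkD (x y : ℂ) : DualNumber ℂ :=
  TrivSqZeroExt.inl x + TrivSqZeroExt.inr y

/-- A series `Σ_{n ≥ 1} (α_n', α_n'') zⁿ` of `Θ^B` is encoded as the function
`ℕ → ℂ²` sending `k` to the coefficient of `z^(k+1)`.  `boxedB f g` is the boxed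
convolution of type B, `f ⊛^B g`. -/
noncomputable def boxedB (f g : ℕ → DualNumber ℂ) : ℕ → DualNumber ℂ :=
  fun k => mkD
    (gammaFst (fun j => (f (j-1)).fst) (fun j => (g (j-1)).fst) (k+1))
    (gammaSnd (fun j => (f (j-1)).fst) (fun j => (f (j-1)).snd)
              (fun j => (g (j-1)).fst) (fun j => (g (j-1)).snd) (k+1))

/-- The series `Δ'(z) = (1,0) z`. -/
noncomputable def deltaB : ℕ → DualNumber ℂ := fun k => if k = 0 then 1 else 0

/-- The boxed convolution of type A with coefficients in a commutative unital
algebra `C` (series encoded as in `boxedB`: index `k` holds the coefficient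
of `z^(k+1)`). -/
noncomputable def boxedA {C : Type*} [CommRing C] (f g : ℕ → C) : ℕ → C :=
  fun k =>
    ∑ᶠ (pq : Set (Set (Fin (k+1))) × Set (Set (Fin (k+1))))
      (_ : NCPart pq.1 ∧ IsKr (k+1) pq.1 pq.2),
      (∏ᶠ F ∈ pq.1, f (F.ncard - 1)) * (∏ᶠ E ∈ pq.2, g (E.ncard - 1))

end NCPB

namespace NCPB

open Equiv

/-- The space of rational functions that are invariant under a permutation. -/
def fixSpace {α : Type} (σ : Perm α) : Submodule ℚ (α → ℚ) where
  carrier := {f | ∀ x, f (σ x) = f x}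
  add_mem' hf hg x := by simp [hf x, hg x]
  zero_mem' x := rfl
  smul_mem' c f hf x := by simp [hf x]

/-- The number of orbits of a permutation, as the dimension of its space of invariant functions. -/
noncomputable def numOrb {α : Type} (σ : Perm α) : ℕ := Module.finrank ℚ (fixSpace σ)

theorem mem_fixSpace {α : Type} {σ : Perm α} {f : α → ℚ} :
    f ∈ fixSpace σ ↔ ∀ x, f (σ x) = f x := Iff.rfl

theorem fixSpace_inf_le {α : Type} (P R : Perm α) :
    fixSpace P ⊓ fixSpace R ≤ fixSpace (P * R) := by
  rintro f ⟨hP, hR⟩ x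
  rw [Perm.mul_apply, hP (R x), hR x]

theorem numOrb_add_le {α : Type} [Finite α] (P R : Perm α) :
    numOrb P + numOrb R ≤ Nat.card α + numOrb (P * R) := by
  have := Fintype.ofFinite α
  have h1 := Submodule.finrank_sup_add_finrank_inf_eq (fixSpace P) (fixSpace R)
  have h2 : Module.finrank ℚ ↥(fixSpace P ⊔ fixSpace R) ≤ Nat.card α := by
    simpa using Submodule.finrank_le (fixSpace P ⊔ fixSpace R)
  have h3 := Submodule.finrank_mono (fixSpace_inf_le P R)
  unfold numOrb
  omega

/-- The factorization of `P * R` into `P` and `R` has the largest possible number of orbits. -/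
def IsMinFact {α : Type} (P R : Perm α) : Prop :=
  numOrb P + numOrb R = Nat.card α + numOrb (P * R)

theorem IsMinFact.fixSpace_eq {α : Type} [Finite α] {P R : Perm α} (h : IsMinFact P R) :
    fixSpace (P * R) = fixSpace P ⊓ fixSpace R := by
  have := Fintype.ofFinite α
  symm
  refine Submodule.eq_of_le_of_finrank_le (fixSpace_inf_le P R) ?_
  have h1 := Submodule.finrank_sup_add_finrank_inf_eq (fixSpace P) (fixSpace R)
  have h2 : Module.finrank ℚ ↥(fixSpace P ⊔ fixSpace R) ≤ Nat.card α := by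
    simpa using Submodule.finrank_le (fixSpace P ⊔ fixSpace R)
  unfold IsMinFact numOrb at h
  omega

/-- A set invariant under `P * R` is invariant under both factors of a minimal factorization. -/
theorem IsMinFact.mem_iff {α : Type} [Finite α] {P R : Perm α} (h : IsMinFact P R) {S : Set α}
    (hS : ∀ x, (P * R) x ∈ S ↔ x ∈ S) : (∀ x, P x ∈ S ↔ x ∈ S) ∧ ∀ x, R x ∈ S ↔ x ∈ S := by
  have hf : S.indicator (1 : α → ℚ) ∈ fixSpace (P * R) := by
    intro x
    by_cases hx : x ∈ S
    · rw [Set.indicator_of_mem hx, Set.indicator_of_mem ((hS x).2 hx)]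
      rfl
    · rw [Set.indicator_of_notMem hx, Set.indicator_of_notMem (mt (hS x).1 hx)]
  rw [h.fixSpace_eq] at hf
  have key : ∀ σ : Perm α, S.indicator (1 : α → ℚ) ∈ fixSpace σ → ∀ x, σ x ∈ S ↔ x ∈ S := by
    intro σ hσ x
    have := hσ x
    by_cases hx : x ∈ S <;> by_cases hy : σ x ∈ S <;> simp_all
  exact ⟨key P hf.1, key R hf.2⟩

theorem isMinFact_triple {α : Type} [Finite α] (P R S : Perm α) :
    IsMinFact (P * R) S ∧ IsMinFact P R ↔ IsMinFact P (R * S) ∧ IsMinFact R S := by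
  have h1 := numOrb_add_le P R
  have h2 := numOrb_add_le (P * R) S
  have h3 := numOrb_add_le P (R * S)
  have h4 := numOrb_add_le R S
  unfold IsMinFact
  rw [mul_assoc] at *
  omega

theorem numOrb_congr {α β : Type} {σ : Perm α} {σ' : Perm β} (e : α ≃ β)
    (h : ∀ a, e (σ a) = σ' (e a)) : numOrb σ = numOrb σ' := by
  have h' : ∀ b, e.symm (σ' b) = σ (e.symm b) := by
    intro b
    rw [Equiv.symm_apply_eq, h, e.apply_symm_apply]
  refine LinearEquiv.finrank_eq
    { toFun := fun f => ⟨fun b => f.1 (e.symm b), fun b => by simp only [h', f.2 _]⟩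
      invFun := fun f => ⟨fun a => f.1 (e a), fun a => by simp only [h, f.2 _]⟩
      map_add' := fun f g => rfl
      map_smul' := fun c f => rfl
      left_inv := fun f => by ext; simp
      right_inv := fun f => by ext; simp }

theorem numOrb_sumCongr {α β : Type} [Finite α] [Finite β] (σ : Perm α) (σ' : Perm β) :
    numOrb (Perm.sumCongr σ σ') = numOrb σ + numOrb σ' := by
  have := Fintype.ofFinite α
  have := Fintype.ofFinite β
  unfold numOrb
  rw [← Module.finrank_prod]
  refine LinearEquiv.finrank_eq
    { toFun := fun f => (⟨fun a => f.1 (Sum.inl a), fun a => f.2 (Sum.inl a)⟩,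
        ⟨fun a => f.1 (Sum.inr a), fun a => f.2 (Sum.inr a)⟩)
      invFun := fun f => ⟨Sum.elim f.1.1 f.2.1, fun x => by
        rcases x with a | a
        · exact f.1.2 a
        · exact f.2.2 a⟩
      map_add' := fun f g => rfl
      map_smul' := fun c f => rfl
      left_inv := fun f => by ext x; rcases x with a | a <;> rfl
      right_inv := fun f => rfl }

theorem numOrb_one {α : Type} [Finite α] : numOrb (1 : Perm α) = Nat.card α := by
  have := Fintype.ofFinite α
  have : fixSpace (1 : Perm α) = ⊤ := by
    ext f
    simp [mem_fixSpace]
  rw [numOrb, this]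
  simp

theorem apply_eq_of_sameCycle {α : Type} [Finite α] {σ : Perm α} {f : α → ℚ}
    (hf : f ∈ fixSpace σ) {x y : α} (h : σ.SameCycle x y) : f x = f y := by
  obtain ⟨k, rfl⟩ := h.exists_nat_pow_eq
  clear h
  induction k with
  | zero => rfl
  | succ k ih => rw [pow_succ', Perm.mul_apply, hf, ih]

/-- The number of orbits is the cardinality of any transversal. -/
theorem numOrb_eq_ncard {α : Type} [Finite α] (σ : Perm α) (T : Set α)
    (hT : ∀ x, ∃ t ∈ T, σ.SameCycle x t)
    (hT' : ∀ s ∈ T, ∀ t ∈ T, σ.SameCycle s t → s = t) : numOrb σ = T.ncard := by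
  have := Fintype.ofFinite α
  choose r hr hr' using hT
  let φ : fixSpace σ →ₗ[ℚ] (T → ℚ) :=
    { toFun := fun f t => f.1 t
      map_add' := fun f g => rfl
      map_smul' := fun c f => rfl }
  have hφ : Function.Bijective φ := by
    constructor
    · intro f g hfg
      ext x
      rw [apply_eq_of_sameCycle f.2 (hr' x), apply_eq_of_sameCycle g.2 (hr' x)]
      exact congrFun hfg ⟨r x, hr x⟩
    · intro g
      refine ⟨⟨fun x => g ⟨r x, hr x⟩, fun x => ?_⟩, ?_⟩
      · have : r (σ x) = r x := hT' _ (hr _) _ (hr _)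
          ((hr' (σ x)).symm.trans (Perm.sameCycle_apply_left.2 (hr' x)))
        simp only [this]
      · ext t
        have : r t = t := hT' _ (hr _) _ t.2 (hr' t).symm
        change g ⟨r t, _⟩ = g t
        congr 1
        exact Subtype.ext this
  unfold numOrb
  rw [(LinearEquiv.ofBijective φ hφ).finrank_eq]
  rw [Module.finrank_fintype_fun_eq_card, ← Nat.card_eq_fintype_card, Nat.card_coe_set_eq]

theorem card_le_numOrb_swap {α : Type} [Finite α] [DecidableEq α] (i k : α) :
    Nat.card α ≤ numOrb (swap i k) + 1 := by
  have := Fintype.ofFinite α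
  let φ : (α → ℚ) →ₗ[ℚ] ℚ := LinearMap.proj (R := ℚ) (φ := fun _ : α => ℚ) i - LinearMap.proj k
  have h1 := φ.finrank_range_add_finrank_ker
  have h2 := Submodule.finrank_le (LinearMap.range φ)
  have h3 : LinearMap.ker φ ≤ fixSpace (swap i k) := by
    intro f hf x
    have : f i = f k := by simpa [φ, sub_eq_zero] using hf
    by_cases hi : x = i
    · subst hi; simp [this]
    by_cases hk : x = k
    · subst hk; simp [this]
    rw [swap_apply_of_ne_of_ne hi hk]
  have h4 := Submodule.finrank_mono h3
  simp at h1 h2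
  unfold numOrb
  rw [Nat.card_eq_fintype_card]
  omega

theorem finRotate_val {n : ℕ} (i : Fin n) :
    (finRotate n i : ℕ) = if i.val + 1 = n then 0 else i.val + 1 := by
  cases n with
  | zero => exact i.elim0
  | succ k =>
    split_ifs with h
    · have : i = Fin.last k := Fin.ext (by simpa using h)
      simp [this]
    · have : i ≠ Fin.last k := fun h' => h (by simp [h'])
      rw [coe_finRotate_of_ne_last this]

theorem mem_of_sameCycle {α : Type} [Finite α] {σ : Perm α} {U : Set α}
    (hU : ∀ x ∈ U, σ x ∈ U) {x y : α} (h : σ.SameCycle x y) (hx : x ∈ U) : y ∈ U := by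
  obtain ⟨k, rfl⟩ := h.exists_nat_pow_eq
  clear h
  induction k with
  | zero => exact hx
  | succ k ih => rw [pow_succ', Perm.mul_apply]; exact hU _ ih

theorem finRotate_sameCycle {n : ℕ} (i j : Fin n) : (finRotate n).SameCycle i j := by
  have key : ∀ k (hk : k < n), (finRotate n).SameCycle ⟨0, by omega⟩ ⟨k, hk⟩ := by
    intro k
    induction k with
    | zero => intro hk; rfl
    | succ k ih =>
      intro hk
      refine (ih (by omega)).trans ?_
      have : finRotate n ⟨k, by omega⟩ = ⟨k + 1, hk⟩ := by
        apply Fin.ext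
        rw [finRotate_val, if_neg (by simp; omega)]
      rw [← this, Perm.sameCycle_apply_right]
  exact (key i i.2).symm.trans (key j j.2)

theorem numOrb_finRotate {n : ℕ} (hn : 0 < n) : numOrb (finRotate n) = 1 := by
  rw [numOrb_eq_ncard (finRotate n) {⟨0, hn⟩} (fun x => ⟨_, rfl, finRotate_sameCycle _ _⟩)
    (by rintro s rfl t rfl -; rfl), Set.ncard_singleton]

/-- A permutation whose orbits form a non-crossing partition and which maps every element to the
next one of its orbit, in the cyclic order. -/
structure IsNCPerm {n : ℕ} (P : Perm (Fin n)) : Prop where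
  gap : ∀ i x y, i < x → x < P i → P.SameCycle x y → i < y ∧ y < P i
  wrap : ∀ i x y, P i ≤ i → P i ≤ x → x ≤ i → P.SameCycle x y → P i ≤ y ∧ y ≤ i

/-- Splitting off the point `i` from its orbit in a minimal factorization of the long cycle. -/
theorem isMinFact_swap_mul {n : ℕ} {P R : Perm (Fin n)} (hc : P * R = finRotate n)
    (h : IsMinFact P R) (i : Fin n) (hi : P i ≠ i) : IsMinFact (swap i (P i) * P) R := by
  have hn : 0 < n := i.pos
  have hlt : fixSpace P < fixSpace (swap i (P i) * P) := by
    refine lt_of_le_of_ne ?_ ?_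
    · intro f hf x
      rw [Perm.mul_apply, ← hf x]
      by_cases h1 : P x = i
      · rw [h1, swap_apply_left, hf]
      by_cases h2 : P x = P i
      · rw [h2, swap_apply_right, hf]
      rw [swap_apply_of_ne_of_ne h1 h2]
    · intro heq
      have hmem : Set.indicator {i} (1 : Fin n → ℚ) ∈ fixSpace (swap i (P i) * P) := by
        intro x
        by_cases hx : x = i
        · subst hx; simp
        · have : (swap i (P i) * P) x ≠ i := by
            rw [Perm.mul_apply]
            intro h'
            rw [swap_apply_eq_iff, swap_apply_left] at h'
            exact hx (P.injective h')
          rw [Set.indicator_of_notMem (by simpa using this),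
            Set.indicator_of_notMem (by simpa using hx)]
      rw [← heq] at hmem
      have := hmem i
      simp [hi] at this
  have h1 := Submodule.finrank_lt_finrank_of_lt hlt
  have h2 := card_le_numOrb_swap i (P i)
  have h3 := numOrb_add_le (swap i (P i)) (swap i (P i) * finRotate n)
  rw [← mul_assoc, swap_mul_self, one_mul, numOrb_finRotate hn] at h3
  have h4 := numOrb_add_le (swap i (P i) * P) R
  unfold IsMinFact at h ⊢
  rw [mul_assoc, hc] at *
  rw [numOrb_finRotate hn] at h
  change numOrb P < numOrb (swap i (P i) * P) at h1
  omega

theorem IsMinFact.isNCPerm {n : ℕ} {P R : Perm (Fin n)} (hc : P * R = finRotate n)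
    (h : IsMinFact P R) : IsNCPerm P := by
  have key : ∀ i, P i ≠ i → ∀ S : Set (Fin n),
      (∀ x, x ∈ S ↔ (min i (P i) ≤ x ∧ x < max i (P i))) →
      ∀ x, swap i (P i) (P x) ∈ S ↔ x ∈ S := by
    intro i hi S hS
    refine ((isMinFact_swap_mul hc h i hi).mem_iff (S := S) ?_).1
    intro x
    rw [mul_assoc, hc, Perm.mul_apply, hS, hS]
    have hx := finRotate_val x
    generalize finRotate n x = y at hx
    generalize P i = k at *
    rw [swap_apply_def]
    rcases lt_or_gt_of_ne hi with hik | hik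
    · rw [min_eq_right hik.le, max_eq_left hik.le]
      split_ifs at hx ⊢ <;> grind
    · rw [min_eq_left hik.le, max_eq_right hik.le]
      split_ifs at hx ⊢ <;> grind
  constructor
  · intro i x y hix hxi hxy
    have hi : i < P i := hix.trans hxi
    have k := key i hi.ne' {x | i ≤ x ∧ x < P i}
      (fun x => by rw [min_eq_left hi.le, max_eq_right hi.le]; rfl)
    refine mem_of_sameCycle (U := {x | i < x ∧ x < P i}) ?_ hxy ⟨hix, hxi⟩
    rintro z ⟨hz1, hz2⟩
    have kz := (k z).2 ⟨hz1.le, hz2⟩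
    have h1 : P z ≠ P i := fun h => hz1.ne' (P.injective h)
    by_cases h2 : P z = i
    · rw [h2, swap_apply_left] at kz
      exact absurd kz.2 (lt_irrefl _)
    · rw [swap_apply_of_ne_of_ne h2 h1] at kz
      exact ⟨lt_of_le_of_ne kz.1 (Ne.symm h2), kz.2⟩
  · intro i x y hi h1 h2 hxy
    rcases hi.eq_or_lt with hi | hi
    · have hx : x = i := le_antisymm h2 (hi ▸ h1)
      subst hx
      have : y = x := mem_of_sameCycle (U := {x}) (by rintro z rfl; exact hi) hxy rfl
      rw [this, hi]
      exact ⟨le_rfl, le_rfl⟩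
    have k := key i hi.ne {x | P i ≤ x ∧ x < i}
      (fun x => by rw [min_eq_right hi.le, max_eq_left hi.le]; rfl)
    refine mem_of_sameCycle (U := {x | P i ≤ x ∧ x ≤ i}) ?_ hxy ⟨h1, h2⟩
    rintro z ⟨hz1, hz2⟩
    rcases hz2.eq_or_lt with rfl | hz2
    · exact ⟨le_rfl, hi.le⟩
    have kz := (k z).2 ⟨hz1, hz2⟩
    by_cases h2 : P z = i
    · rw [h2]; exact ⟨hi.le, le_rfl⟩
    · rw [swap_apply_of_ne_of_ne h2 (fun h => hz2.ne (P.injective h))] at kz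
      exact ⟨kz.1, kz.2.le⟩

theorem IsNCPerm.eq_of_sameCycle {n : ℕ} {P P' : Perm (Fin n)} (h : IsNCPerm P)
    (h' : IsNCPerm P') (hs : ∀ x y, P.SameCycle x y ↔ P'.SameCycle x y) : P = P' := by
  ext i
  have a1 : P.SameCycle i (P i) := Perm.sameCycle_apply_right.2 (Perm.SameCycle.refl _ _)
  have a2 : P.SameCycle i (P' i) :=
    (hs _ _).2 (Perm.sameCycle_apply_right.2 (Perm.SameCycle.refl _ _))
  have g1 : P' i ≤ i ∨ P i ≤ P' i := by
    by_contra! hc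
    exact lt_irrefl _ (h.gap i (P' i) i hc.1 hc.2 a2.symm).1
  have g2 : P i ≤ i ∨ P' i ≤ P i := by
    by_contra! hc
    exact lt_irrefl _ (h'.gap i (P i) i hc.1 hc.2 ((hs _ _).1 a1.symm)).1
  have w1 : P i ≤ i → P i ≤ P' i ∧ P' i ≤ i := fun hi =>
    h.wrap i i (P' i) hi hi le_rfl a2
  have w2 : P' i ≤ i → P' i ≤ P i ∧ P i ≤ i := fun hi =>
    h'.wrap i i (P i) hi hi le_rfl ((hs _ _).1 a1)
  grind

/-- The relation of being in the same block of the Kreweras complement: the interval between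
`i` and `j` is a union of classes of `r`. -/
def KrRel {n : ℕ} (r : Fin n → Fin n → Prop) (i j : Fin n) : Prop :=
  ∀ a b, r a b → ((i < a ↔ j < a) ↔ (i < b ↔ j < b))

theorem KrRel.equivalence {n : ℕ} (r : Fin n → Fin n → Prop) : Equivalence (KrRel r) where
  refl i a b _ := by simp
  symm h a b hab := by have := h a b hab; tauto
  trans h h' a b hab := by have := h a b hab; have := h' a b hab; tauto

theorem IsNCPerm.krRel_apply {n : ℕ} {P R : Perm (Fin n)} (hc : P * R = finRotate n)
    (h : IsNCPerm P) (i : Fin n) : KrRel P.SameCycle i (R i) := by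
  intro a b hab
  have hi : P (R i) = finRotate n i := by rw [← hc, Perm.mul_apply]
  have hv := finRotate_val i
  rw [← hi] at hv
  generalize R i = j at *
  have g1 := h.gap j a b
  have g2 := h.gap j b a
  have w1 := h.wrap j a b
  have w2 := h.wrap j b a
  have hba := hab.symm
  simp only [hab, hba, forall_const] at g1 g2 w1 w2
  generalize P j = k at *
  clear h hab hba hi hc
  simp only [Fin.lt_def, Fin.le_def] at *
  have := a.2
  have := b.2
  split_ifs at hv <;> omega

theorem IsNCPerm.sameCycle_iff_krRel {n : ℕ} {P R : Perm (Fin n)} (hc : P * R = finRotate n)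
    (h : IsNCPerm P) (i j : Fin n) : R.SameCycle i j ↔ KrRel P.SameCycle i j := by
  have e := KrRel.equivalence P.SameCycle
  constructor
  · intro hij
    exact mem_of_sameCycle (U := {j | KrRel P.SameCycle i j})
      (fun x hx => e.trans hx (h.krRel_apply hc x)) hij (e.refl i)
  have key : ∀ d : ℕ, ∀ i j : Fin n, i.val < j.val → j.val - i.val ≤ d →
      KrRel P.SameCycle i j → R.SameCycle i j := by
    intro d
    induction d with
    | zero => intro i j h1 h2; omega
    | succ d ih =>
      intro i j h1 h2 hij
      have hi : P (R i) = finRotate n i := by rw [← hc, Perm.mul_apply]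
      have hv := finRotate_val i
      rw [← hi, if_neg (by omega)] at hv
      have h3 := hij (R i) (P (R i)) (Perm.sameCycle_apply_right.2 (Perm.SameCycle.refl _ _))
      have h4 : R.SameCycle i (R i) := Perm.sameCycle_apply_right.2 (Perm.SameCycle.refl _ _)
      refine h4.trans ?_
      have h5 := e.trans (e.symm (h.krRel_apply hc i)) hij
      generalize R i = k at *
      simp only [Fin.lt_def] at h3
      by_cases hk : k = j
      · rw [hk]
      · have : k.val ≠ j.val := fun h => hk (Fin.ext h)
        exact ih k j (by omega) (by omega) h5
  intro hij
  rcases lt_trichotomy i.val j.val with hl | hl | hl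
  · exact key _ i j hl le_rfl hij
  · rw [Fin.ext hl]
  · exact (key _ j i hl le_rfl (e.symm hij)).symm

theorem IsNCPerm.isMinFact {n : ℕ} (hn : 0 < n) {P R : Perm (Fin n)}
    (hc : P * R = finRotate n) (h : IsNCPerm P) : IsMinFact P R := by
  set A : Set (Fin n) := {i | ∀ x, P.SameCycle i x → i ≤ x} with hA
  set B : Set (Fin n) := {i | ∀ x, R.SameCycle i x → x ≤ i} with hB
  have h1 : numOrb P = A.ncard := by
    apply numOrb_eq_ncard
    · intro x
      obtain ⟨t, ht, hmin⟩ := Set.exists_min_image {y | P.SameCycle x y} id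
        (Set.toFinite _) ⟨x, Perm.SameCycle.refl _ _⟩
      exact ⟨t, fun y hy => hmin y (Perm.SameCycle.trans ht hy), ht⟩
    · intro s hs t ht hst
      exact le_antisymm (hs _ hst) (ht _ hst.symm)
  have h2 : numOrb R = B.ncard := by
    apply numOrb_eq_ncard
    · intro x
      obtain ⟨t, ht, hmax⟩ := Set.exists_max_image {y | R.SameCycle x y} id
        (Set.toFinite _) ⟨x, Perm.SameCycle.refl _ _⟩
      exact ⟨t, fun y hy => hmax y (Perm.SameCycle.trans ht hy), ht⟩
    · intro s hs t ht hst
      exact le_antisymm (ht _ hst.symm) (hs _ hst)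
  have h3 : A = insert ⟨0, hn⟩ (finRotate n '' Bᶜ) := by
    ext s
    constructor
    · intro hs
      by_cases h0 : s.val = 0
      · left; exact Fin.ext h0
      right
      refine ⟨(finRotate n).symm s, ?_, Equiv.apply_symm_apply _ _⟩
      have hi : finRotate n ((finRotate n).symm s) = s := Equiv.apply_symm_apply _ _
      generalize (finRotate n).symm s = i at *
      have hv := finRotate_val i
      rw [hi] at hv
      rw [if_neg (by intro h; rw [if_pos h] at hv; exact h0 hv)] at hv
      intro hiB
      have hle := hiB (R i) (Perm.sameCycle_apply_right.2 (Perm.SameCycle.refl _ _))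
      have hs' : P (R i) = s := by rw [← hi, ← hc, Perm.mul_apply]
      have := hs (R i) (by rw [← hs']; exact Perm.sameCycle_apply_left.2 (Perm.SameCycle.refl _ _))
      simp only [Fin.le_def] at *
      omega
    · rintro (rfl | ⟨i, hi, rfl⟩)
      · intro x _; exact Nat.zero_le _
      · simp only [hB, Set.mem_compl_iff, Set.mem_ofPred_eq, not_forall, not_le] at hi
        obtain ⟨j, hj, hij⟩ := hi
        rw [h.sameCycle_iff_krRel hc] at hj
        intro x hx
        have := hj _ _ hx
        have hv := finRotate_val i
        generalize finRotate n i = s at *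
        simp only [Fin.le_def, Fin.lt_def] at *
        have := j.2
        rw [if_neg (by omega)] at hv
        omega
  have h4 : (⟨0, hn⟩ : Fin n) ∉ finRotate n '' Bᶜ := by
    rintro ⟨i, hi, h0⟩
    have hv := finRotate_val i
    rw [h0] at hv
    split_ifs at hv with hin
    apply hi
    intro x _
    have := x.2
    simp only [Fin.le_def]
    omega
  have h5 : A.ncard = (Bᶜ).ncard + 1 := by
    rw [h3, Set.ncard_insert_of_notMem h4,
      Set.ncard_image_of_injective _ (finRotate n).injective]
  have h6 := Set.ncard_add_ncard_compl B
  unfold IsMinFact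
  rw [hc, numOrb_finRotate hn]
  omega

/-- Being in the same member of a collection of sets. -/
def SameBlock {α : Type} (p : Set (Set α)) (x y : α) : Prop := ∃ B ∈ p, x ∈ B ∧ y ∈ B

/-- The classes of a relation. -/
def classes {α : Type} (r : α → α → Prop) : Set (Set α) := Set.range fun x => {y | r x y}

theorem IsPartition.equivalence {α : Type} {p : Set (Set α)} (hp : IsPartition p) :
    Equivalence (SameBlock p) where
  refl x := by
    obtain ⟨B, ⟨hB, hx⟩, _⟩ := hp.2 x
    exact ⟨B, hB, hx, hx⟩
  symm := fun ⟨B, hB, hx, hy⟩ => ⟨B, hB, hy, hx⟩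
  trans := by
    rintro x y z ⟨B, hB, hx, hy⟩ ⟨C, hC, hy', hz⟩
    have := (hp.2 y).unique ⟨hB, hy⟩ ⟨hC, hy'⟩
    subst this
    exact ⟨B, hB, hx, hz⟩

theorem IsPartition.eq_classes {α : Type} {p : Set (Set α)} (hp : IsPartition p) :
    p = classes (SameBlock p) := by
  have key : ∀ B ∈ p, ∀ x ∈ B, {y | SameBlock p x y} = B := by
    intro B hB x hx
    ext y
    constructor
    · rintro ⟨C, hC, hx', hy⟩
      rwa [(hp.2 x).unique ⟨hB, hx⟩ ⟨hC, hx'⟩]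
    · intro hy
      exact ⟨B, hB, hx, hy⟩
  ext B
  constructor
  · intro hB
    obtain ⟨x, hx⟩ := hp.1 B hB
    exact ⟨x, key B hB x hx⟩
  · rintro ⟨x, rfl⟩
    obtain ⟨B, ⟨hB, hx⟩, _⟩ := hp.2 x
    simp only [key B hB x hx]
    exact hB

theorem isPartition_classes {α : Type} {r : α → α → Prop} (hr : Equivalence r) :
    IsPartition (classes r) := by
  constructor
  · rintro _ ⟨x, rfl⟩
    exact ⟨x, hr.refl x⟩
  · intro x
    refine ⟨{y | r x y}, ⟨⟨x, rfl⟩, hr.refl x⟩, ?_⟩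
    rintro _ ⟨⟨z, rfl⟩, hz⟩
    ext y
    exact ⟨fun h => hr.trans (hr.symm hz) h, fun h => hr.trans hz h⟩

theorem sameBlock_classes {α : Type} {r : α → α → Prop} (hr : Equivalence r) (x y : α) :
    SameBlock (classes r) x y ↔ r x y := by
  constructor
  · rintro ⟨_, ⟨z, rfl⟩, hx, hy⟩
    exact hr.trans (hr.symm hx) hy
  · intro h
    exact ⟨_, ⟨x, rfl⟩, hr.refl x, h⟩

theorem sameCycle_equivalence {α : Type} (P : Perm α) : Equivalence P.SameCycle :=
  ⟨Perm.SameCycle.refl P, fun h => h.symm, fun h h' => h.trans h'⟩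

/-- The partition into orbits of a permutation. -/
def orbs {α : Type} (P : Perm α) : Set (Set α) := classes P.SameCycle

theorem sameBlock_orbs {α : Type} (P : Perm α) (x y : α) :
    SameBlock (orbs P) x y ↔ P.SameCycle x y :=
  sameBlock_classes (sameCycle_equivalence P) x y

theorem isNC_iff {α : Type} [LinearOrder α] {p : Set (Set α)} (hp : IsPartition p) :
    IsNC p ↔ ∀ a b c d, a < b → b < c → c < d → SameBlock p a c → SameBlock p b d →
      SameBlock p a b := by
  constructor
  · rintro h a b c d hab hbc hcd ⟨B, hB, ha, hc⟩ ⟨C, hC, hb, hd⟩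
    exact ⟨B, hB, ha, h B hB C hC a b c d hab hbc hcd ha hc hb hd⟩
  · intro h B hB C hC a b c d hab hbc hcd ha hc hb hd
    obtain ⟨B', hB', ha', hb'⟩ := h a b c d hab hbc hcd ⟨B, hB, ha, hc⟩ ⟨C, hC, hb, hd⟩
    rwa [(hp.2 a).unique ⟨hB, ha⟩ ⟨hB', ha'⟩]

theorem IsNCPerm.ncPart {n : ℕ} {P : Perm (Fin n)} (h : IsNCPerm P) : NCPart (orbs P) := by
  have hp : IsPartition (orbs P) := isPartition_classes (sameCycle_equivalence P)
  refine ⟨hp, (isNC_iff hp).2 ?_⟩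
  simp only [sameBlock_orbs]
  intro a b c d hab hbc hcd hac hbd
  by_contra hn
  obtain ⟨i, ⟨hi, hib⟩, hmax⟩ := Set.exists_max_image {y | P.SameCycle a y ∧ y < b} id
    (Set.toFinite _) ⟨a, Perm.SameCycle.refl _ _, hab⟩
  have h1 : P.SameCycle a (P i) := Perm.sameCycle_apply_right.2 hi
  have h2 : i < P i := by
    by_contra! hc
    have := (h.wrap i i c hc hc le_rfl (hi.symm.trans hac)).2
    exact absurd (hib.trans hbc) (not_lt.2 this)
  have h3 : b < P i := by
    rcases lt_trichotomy (P i) b with h4 | h4 | h4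
    · exact absurd h2 (not_lt.2 (hmax _ ⟨h1, h4⟩))
    · exact absurd (h4 ▸ h1) hn
    · exact h4
  have h4 := (h.gap i b d hib h3 hbd).2
  have h5 : P i ≤ c := by
    by_contra! hc
    exact lt_irrefl _ (h.gap i c i (hib.trans hbc) hc (hac.symm.trans hi)).1
  exact absurd h4 (not_lt.2 (h5.trans hcd.le))

theorem exists_isNCPerm {n : ℕ} {r : Fin n → Fin n → Prop} (hr : Equivalence r)
    (hnc : ∀ a b c d, a < b → b < c → c < d → r a c → r b d → r a b) :
    ∃ P : Perm (Fin n), IsNCPerm P ∧ ∀ x y, P.SameCycle x y ↔ r x y := by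
  have hex : ∀ x, ∃ y, r x y ∧ ((x < y ∧ ∀ z, r x z → x < z → y ≤ z) ∨
      ((∀ z, r x z → z ≤ x) ∧ ∀ z, r x z → y ≤ z)) := by
    intro x
    by_cases h : ∃ y, r x y ∧ x < y
    · obtain ⟨y, ⟨h1, h2⟩, hmin⟩ := Set.exists_min_image {y | r x y ∧ x < y} id
        (Set.toFinite _) h
      exact ⟨y, h1, Or.inl ⟨h2, fun z hz hxz => hmin z ⟨hz, hxz⟩⟩⟩
    · push Not at h
      obtain ⟨y, h1, hmin⟩ := Set.exists_min_image {y | r x y} id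
        (Set.toFinite _) ⟨x, hr.refl x⟩
      exact ⟨y, h1, Or.inr ⟨h, hmin⟩⟩
  choose N hN1 hN2 using hex
  have hinj : Function.Injective N := by
    have key : ∀ x y, x < y → N x ≠ N y := by
      intro x y hxy hN
      have hrxy : r x y := hr.trans (hN1 x) (hN ▸ hr.symm (hN1 y))
      rcases hN2 x with ⟨h1, h2⟩ | ⟨h1, h2⟩
      · have h3 := h2 y hrxy hxy
        rcases hN2 y with ⟨h4, h5⟩ | ⟨h4, h5⟩
        · exact absurd h4 (not_lt.2 (hN ▸ h3))
        · exact absurd h1 (not_lt.2 (hN ▸ h5 x (hr.symm hrxy)))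
      · exact absurd hxy (not_lt.2 (h1 y hrxy))
    intro x y h
    rcases lt_trichotomy x y with h' | h' | h'
    · exact absurd h (key x y h')
    · exact h'
    · exact absurd h.symm (key y x h')
  let P : Perm (Fin n) := Equiv.ofBijective N (Finite.injective_iff_bijective.1 hinj)
  have hP : ∀ x, P x = N x := fun x => rfl
  have hmin : ∀ k : ℕ, ∀ x : Fin n, x.val ≤ k →
      ∃ m, P.SameCycle m x ∧ r x m ∧ ∀ z, r x z → m ≤ z := by
    intro k
    induction k with
    | zero =>
      intro x hx
      refine ⟨x, Perm.SameCycle.refl _ _, hr.refl x, fun z _ => ?_⟩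
      simp only [Fin.le_def]; omega
    | succ k ih =>
      intro x hx
      obtain ⟨u, hu⟩ := P.surjective x
      have h1 : P.SameCycle u x := hu ▸ Perm.sameCycle_apply_right.2 (Perm.SameCycle.refl _ _)
      rw [hP] at hu
      have h2 : r u x := hu ▸ hN1 u
      rcases hN2 u with ⟨h3, _⟩ | ⟨_, h4⟩
      · rw [hu] at h3
        obtain ⟨m, hm1, hm2, hm3⟩ := ih u (by simp only [Fin.lt_def] at h3; omega)
        exact ⟨m, hm1.trans h1, hr.trans (hr.symm h2) hm2, fun z hz => hm3 z (hr.trans h2 hz)⟩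
      · rw [hu] at h4
        exact ⟨x, Perm.SameCycle.refl _ _, hr.refl x, fun z hz => h4 z (hr.trans h2 hz)⟩
  have hs : ∀ x y, P.SameCycle x y ↔ r x y := by
    intro x y
    constructor
    · intro h
      exact mem_of_sameCycle (U := {y | r x y}) (fun z hz => hr.trans hz (hN1 z)) h (hr.refl x)
    · intro h
      obtain ⟨m, hm1, hm2, hm3⟩ := hmin _ x le_rfl
      obtain ⟨m', hm1', hm2', hm3'⟩ := hmin _ y le_rfl
      have : m = m' := le_antisymm (hm3 _ (hr.trans h hm2')) (hm3' _ (hr.trans (hr.symm h) hm2))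
      subst this
      exact hm1.symm.trans hm1'
  refine ⟨P, ⟨?_, ?_⟩, hs⟩
  · intro i x y hix hxi hxy
    rw [hs] at hxy
    rw [hP] at hxi ⊢
    have hi := hN1 i
    rcases hN2 i with ⟨h1, h2⟩ | ⟨_, h2⟩
    swap
    · exact absurd (hix.trans hxi) (not_lt.2 (h2 i (hr.refl i)))
    have hnx : ¬ r i x := fun h => absurd hxi (not_lt.2 (h2 x h hix))
    have hy1 : y ≠ i := by rintro rfl; exact hnx (hr.symm hxy)
    have hy2 : y ≠ N i := by rintro rfl; exact hnx (hr.trans hi (hr.symm hxy))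
    constructor
    · by_contra! hyi
      have := hnc y i x (N i) (lt_of_le_of_ne hyi hy1) hix hxi (hr.symm hxy) hi
      exact hnx (hr.trans (hr.symm this) (hr.symm hxy))
    · by_contra! hyi
      exact hnx (hnc i x (N i) y hix hxi (lt_of_le_of_ne hyi hy2.symm) hi hxy)
  · intro i x y hi hx1 hx2 hxy
    rw [hs] at hxy
    rw [hP] at hi hx1 ⊢
    have hiN := hN1 i
    rcases hN2 i with ⟨h1, _⟩ | ⟨h1, h2⟩
    · exact absurd h1 (not_lt.2 hi)
    by_cases hrx : r i x
    · exact ⟨h2 y (hr.trans hrx hxy), h1 y (hr.trans hrx hxy)⟩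
    have hx3 : x ≠ i := by rintro rfl; exact hrx (hr.refl x)
    have hx4 : x ≠ N i := by rintro rfl; exact hrx hiN
    have hx1' := lt_of_le_of_ne hx1 hx4.symm
    have hx2' := lt_of_le_of_ne hx2 hx3
    constructor
    · by_contra! hy
      have := hnc y (N i) x i hy hx1' hx2' (hr.symm hxy) (hr.symm hiN)
      exact hrx (hr.trans hiN (hr.trans (hr.symm this) (hr.symm hxy)))
    · by_contra! hy
      have := hnc (N i) x i y hx1' hx2' hy (hr.symm hiN) hxy
      exact hrx (hr.trans hiN this)

theorem ncPart_krRel {n : ℕ} (r : Fin n → Fin n → Prop) : NCPart (classes (KrRel r)) := by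
  have e := KrRel.equivalence r
  have hp := isPartition_classes e
  refine ⟨hp, (isNC_iff hp).2 ?_⟩
  simp only [sameBlock_classes e]
  intro a b c d hab hbc hcd hac hbd x y hxy
  have h1 := hac x y hxy
  have h2 := hbd x y hxy
  simp only [Fin.lt_def] at *
  omega

theorem isPartition_interleave {n : ℕ} {p q : Set (Set (Fin n))} (hp : IsPartition p)
    (hq : IsPartition q) : IsPartition (interleave n p q) := by
  have eo : ∀ i j : Fin n, evens n i ≠ odds n j := by
    intro i j h
    have := congrArg Fin.val h
    simp only [evens, odds] at this
    omega
  have ei : Function.Injective (evens n) := by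
    intro i j h
    have := congrArg Fin.val h
    simp only [evens] at this
    exact Fin.ext (by omega)
  have oi : Function.Injective (odds n) := by
    intro i j h
    have := congrArg Fin.val h
    simp only [odds] at this
    exact Fin.ext (by omega)
  constructor
  · rintro _ (⟨B, hB, rfl⟩ | ⟨B, hB, rfl⟩)
    · exact (hp.1 B hB).image _
    · exact (hq.1 B hB).image _
  · intro x
    rcases Nat.even_or_odd' x.val with ⟨k, hk | hk⟩
    · obtain ⟨i, rfl⟩ : ∃ i, x = evens n i := ⟨⟨k, by omega⟩, Fin.ext hk⟩
      obtain ⟨B, ⟨hB, hi⟩, hu⟩ := hp.2 i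
      refine ⟨evens n '' B, ⟨Or.inl ⟨B, hB, rfl⟩, i, hi, rfl⟩, ?_⟩
      rintro _ ⟨⟨C, hC, rfl⟩ | ⟨C, hC, rfl⟩, j, hj, hij⟩
      · rw [hu C ⟨hC, ei hij ▸ hj⟩]
      · exact absurd hij.symm (eo _ _)
    · obtain ⟨i, rfl⟩ : ∃ i, x = odds n i := ⟨⟨k, by omega⟩, Fin.ext hk⟩
      obtain ⟨B, ⟨hB, hi⟩, hu⟩ := hq.2 i
      refine ⟨odds n '' B, ⟨Or.inr ⟨B, hB, rfl⟩, i, hi, rfl⟩, ?_⟩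
      rintro _ ⟨⟨C, hC, rfl⟩ | ⟨C, hC, rfl⟩, j, hj, hij⟩
      · exact absurd hij (eo _ _)
      · rw [hu C ⟨hC, oi hij ▸ hj⟩]

theorem krRel_of_ncPart_interleave {n : ℕ} {p q : Set (Set (Fin n))}
    (h : NCPart (interleave n p q)) {i j : Fin n} (hij : SameBlock q i j) :
    KrRel (SameBlock p) i j := by
  obtain ⟨C, hC, hi, hj⟩ := hij
  have key : ∀ i ∈ C, ∀ j ∈ C, ∀ B ∈ p, ∀ a ∈ B, ∀ b ∈ B, i < a → a ≤ j → i < b ∧ b ≤ j := by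
    intro i hi j hj B hB a ha b hb h1 h2
    by_contra hcon
    simp only [Fin.lt_def, Fin.le_def] at h1 h2 hcon
    have hB' : evens n '' B ∈ interleave n p q := Or.inl ⟨B, hB, rfl⟩
    have hC' : odds n '' C ∈ interleave n p q := Or.inr ⟨C, hC, rfl⟩
    rcases Nat.lt_or_ge i.val b.val with h3 | h3
    · obtain ⟨x, _, hx⟩ := h.2 _ hC' _ hB' (odds n i) (evens n a) (odds n j) (evens n b)
        (by simp only [Fin.lt_def, odds, evens]; omega)
        (by simp only [Fin.lt_def, odds, evens]; omega)
        (by simp only [Fin.lt_def, odds, evens]; omega)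
        ⟨i, hi, rfl⟩ ⟨j, hj, rfl⟩ ⟨a, ha, rfl⟩ ⟨b, hb, rfl⟩
      have := congrArg Fin.val hx
      simp only [evens, odds] at this
      omega
    · obtain ⟨x, _, hx⟩ := h.2 _ hB' _ hC' (evens n b) (odds n i) (evens n a) (odds n j)
        (by simp only [Fin.lt_def, odds, evens]; omega)
        (by simp only [Fin.lt_def, odds, evens]; omega)
        (by simp only [Fin.lt_def, odds, evens]; omega)
        ⟨b, hb, rfl⟩ ⟨a, ha, rfl⟩ ⟨i, hi, rfl⟩ ⟨j, hj, rfl⟩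
      have := congrArg Fin.val hx
      simp only [evens, odds] at this
      omega
  rintro a b ⟨B, hB, ha, hb⟩
  have k1 := key i hi j hj B hB a ha b hb
  have k2 := key i hi j hj B hB b hb a ha
  have k3 := key j hj i hi B hB a ha b hb
  have k4 := key j hj i hi B hB b hb a ha
  simp only [Fin.lt_def, Fin.le_def] at *
  omega

theorem ncPart_interleave_krRel {n : ℕ} {p : Set (Set (Fin n))} (hp : NCPart p) :
    NCPart (interleave n p (classes (KrRel (SameBlock p)))) := by
  have hq := ncPart_krRel (SameBlock p)
  refine ⟨isPartition_interleave hp.1 hq.1, ?_⟩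
  have key : ∀ B ∈ p, ∀ C ∈ classes (KrRel (SameBlock p)), ∀ a ∈ B, ∀ b ∈ B, ∀ i ∈ C, ∀ j ∈ C,
      i < a → a ≤ j → i < b ∧ b ≤ j := by
    intro B hB C hC a ha b hb i hi j hj h1 h2
    have e := KrRel.equivalence (SameBlock p)
    have := (sameBlock_classes e i j).1 ⟨C, hC, hi, hj⟩ a b ⟨B, hB, ha, hb⟩
    simp only [Fin.lt_def, Fin.le_def] at *
    omega
  rintro _ (⟨B, hB, rfl⟩ | ⟨B, hB, rfl⟩) _ (⟨C, hC, rfl⟩ | ⟨C, hC, rfl⟩)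
    _ _ _ _ h1 h2 h3 ⟨a, ha, rfl⟩ ⟨c, hc, rfl⟩ ⟨b, hb, rfl⟩ ⟨d, hd, rfl⟩ <;>
    simp only [Fin.lt_def, evens, odds] at h1 h2 h3
  · exact ⟨b, hp.2 B hB C hC a b c d (by simp only [Fin.lt_def]; omega)
      (by simp only [Fin.lt_def]; omega) (by simp only [Fin.lt_def]; omega) ha hc hb hd, rfl⟩
  · have := key B hB C hC c hc a ha b hb d hd
    simp only [Fin.lt_def, Fin.le_def] at this
    omega
  · have := key C hC B hB b hb d hd a ha c hc
    simp only [Fin.lt_def, Fin.le_def] at this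
    omega
  · exact ⟨b, hq.2 B hB C hC a b c d (by simp only [Fin.lt_def]; omega)
      (by simp only [Fin.lt_def]; omega) (by simp only [Fin.lt_def]; omega) ha hc hb hd, rfl⟩

theorem isKr_iff {n : ℕ} {p q : Set (Set (Fin n))} (hp : NCPart p) :
    IsKr n p q ↔ q = classes (KrRel (SameBlock p)) := by
  have e := KrRel.equivalence (SameBlock p)
  constructor
  · rintro ⟨h1, h2, h3⟩
    rw [h1.1.eq_classes]
    congr 1
    ext i j
    constructor
    · exact krRel_of_ncPart_interleave h2
    · intro hij
      obtain ⟨C, hC, hsub⟩ := h3 _ (ncPart_krRel _) (ncPart_interleave_krRel hp) _ ⟨i, rfl⟩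
      exact ⟨C, hC, hsub (e.refl i), hsub hij⟩
  · rintro rfl
    refine ⟨ncPart_krRel _, ncPart_interleave_krRel hp, ?_⟩
    intro q' hq' hq B hB
    obtain ⟨x, hx⟩ := hq'.1.1 B hB
    exact ⟨_, ⟨x, rfl⟩, fun y hy => krRel_of_ncPart_interleave hq ⟨B, hB, hx, hy⟩⟩

theorem orbs_injOn {n : ℕ} {P P' : Perm (Fin n)} (h : IsNCPerm P) (h' : IsNCPerm P')
    (ho : orbs P = orbs P') : P = P' :=
  h.eq_of_sameCycle h' fun x y => by rw [← sameBlock_orbs, ho, sameBlock_orbs]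

theorem IsNCPerm.isKr_orbs {n : ℕ} {P R : Perm (Fin n)} (hc : P * R = finRotate n)
    (h : IsNCPerm P) : IsKr n (orbs P) (orbs R) := by
  rw [isKr_iff h.ncPart, orbs]
  congr 1
  ext i j
  rw [h.sameCycle_iff_krRel hc]
  congr! 1
  ext x y
  rw [sameBlock_orbs]

/-- Minimal factorizations of the long cycle correspond to non-crossing partitions together with
their Kreweras complements. -/
theorem bijOn_orbs {n : ℕ} (hn : 0 < n) :
    Set.BijOn (fun pr : Perm (Fin n) × Perm (Fin n) => (orbs pr.1, orbs pr.2))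
      {pr | pr.1 * pr.2 = finRotate n ∧ IsMinFact pr.1 pr.2}
      {pq | NCPart pq.1 ∧ IsKr n pq.1 pq.2} := by
  refine ⟨?_, ?_, ?_⟩
  · rintro ⟨P, R⟩ ⟨hc, hm⟩
    have h := hm.isNCPerm hc
    exact ⟨h.ncPart, h.isKr_orbs hc⟩
  · rintro ⟨P, R⟩ ⟨hc, hm⟩ ⟨P', R'⟩ ⟨hc', hm'⟩ heq
    have h := orbs_injOn (hm.isNCPerm hc) (hm'.isNCPerm hc') (congrArg Prod.fst heq)
    dsimp only at h hc hc'
    subst h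
    rw [mul_left_cancel (hc.trans hc'.symm)]
  · rintro ⟨p, q⟩ ⟨hp, hq⟩
    dsimp only at hp hq
    obtain ⟨P, hP, hs⟩ := exists_isNCPerm hp.1.equivalence ((isNC_iff hp.1).1 hp.2)
    have hc : P * (P⁻¹ * finRotate n) = finRotate n := mul_inv_cancel_left _ _
    have ho : orbs P = p := by
      rw [hp.1.eq_classes, orbs]
      congr 1
      ext x y
      exact hs x y
    refine ⟨(P, P⁻¹ * finRotate n), ⟨hc, hP.isMinFact hn hc⟩, ?_⟩
    have h1 := hP.isKr_orbs hc
    rw [ho, isKr_iff hp] at h1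
    rw [isKr_iff hp] at hq
    exact Prod.ext ho (h1.trans hq.symm)

/-- A fixed-point-free involution `τ` together with a permutation `σ` commuting with it. -/
structure IsSys {α : Type} (τ σ : Perm α) : Prop where
  invol : ∀ x, τ (τ x) = x
  ne : ∀ x, τ x ≠ x
  comm : Commute σ τ

theorem IsSys.apply_comm {α : Type} {τ σ : Perm α} (h : IsSys τ σ) (x : α) :
    σ (τ x) = τ (σ x) := by
  rw [← Perm.mul_apply, h.comm, Perm.mul_apply]

theorem sameCycle_map_iff {α β : Type} [Finite α] [Finite β] {σ : Perm α} {σ' : Perm β}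
    {f : α → β} (hf : Function.Injective f) (h : ∀ a, f (σ a) = σ' (f a)) (x y : α) :
    σ'.SameCycle (f x) (f y) ↔ σ.SameCycle x y := by
  have key : ∀ k : ℕ, f ((σ ^ k) x) = (σ' ^ k) (f x) := by
    intro k
    induction k with
    | zero => rfl
    | succ k ih => rw [pow_succ', pow_succ', Perm.mul_apply, Perm.mul_apply, h, ih]
  constructor
  · intro hs
    obtain ⟨k, hk⟩ := hs.exists_nat_pow_eq
    exact ⟨k, hf (by rw [zpow_natCast, key, hk])⟩
  · intro hs
    obtain ⟨k, hk⟩ := hs.exists_nat_pow_eq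
    exact ⟨k, by rw [zpow_natCast, ← key, hk]⟩

/-- The orbit of `x` under the group generated by `τ` and `σ`, for `τ` an involution commuting
with `σ`. -/
def orb {α : Type} (τ σ : Perm α) (x : α) : Set α :=
  {y | σ.SameCycle x y ∨ σ.SameCycle x (τ y)}

/-- The weight attached to an orbit, which depends on its size and on whether it is a single
orbit of `σ`. -/
noncomputable def orbWt {A : Type} {α : Type} (w : Bool → ℕ → A) (τ σ : Perm α)
    (O : Set α) : A :=
  if ∃ x ∈ O, σ.SameCycle x (τ x) then w true (O.ncard / 2) else w false (O.ncard / 2)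

/-- The multiplicative function with given weights. -/
noncomputable def wt {A : Type} [CommRing A] (w : Bool → ℕ → A) {α : Type} (τ σ : Perm α) : A :=
  ∏ᶠ O ∈ Set.range (orb τ σ), orbWt w τ σ O

theorem orb_map {α β : Type} [Finite α] [Finite β] {τ σ : Perm α} {τ' σ' : Perm β}
    (h' : IsSys τ' σ') {f : α → β} (hf : Function.Injective f)
    (hσ : ∀ a, f (σ a) = σ' (f a)) (hτ : ∀ a, f (τ a) = τ' (f a)) (x : α) :
    orb τ' σ' (f x) = f '' orb τ σ x := by
  have hr : ∀ z ∈ Set.range f, σ' z ∈ Set.range f := by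
    rintro _ ⟨a, rfl⟩
    exact ⟨σ a, hσ a⟩
  ext y
  constructor
  · rintro (hy | hy)
    · obtain ⟨z, rfl⟩ := mem_of_sameCycle hr hy ⟨x, rfl⟩
      exact ⟨z, Or.inl ((sameCycle_map_iff hf hσ _ _).1 hy), rfl⟩
    · obtain ⟨z, hz⟩ := mem_of_sameCycle hr hy ⟨x, rfl⟩
      have hy' : f (τ z) = y := by rw [hτ, hz, h'.invol]
      refine ⟨τ z, Or.inr ?_, hy'⟩
      rw [← sameCycle_map_iff hf hσ, hτ, hy']
      exact hy
  · rintro ⟨z, hz | hz, rfl⟩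
    · exact Or.inl ((sameCycle_map_iff hf hσ _ _).2 hz)
    · exact Or.inr (by rw [← hτ]; exact (sameCycle_map_iff hf hσ _ _).2 hz)

theorem finprod_orb_map {A : Type} [CommRing A] (w : Bool → ℕ → A) {α β : Type} [Finite α]
    [Finite β] {τ σ : Perm α} {τ' σ' : Perm β} (h' : IsSys τ' σ') {f : α → β}
    (hf : Function.Injective f) (hσ : ∀ a, f (σ a) = σ' (f a))
    (hτ : ∀ a, f (τ a) = τ' (f a)) :
    ∏ᶠ O ∈ orb τ' σ' '' Set.range f, orbWt w τ' σ' O = wt w τ σ := by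
  have h1 : orb τ' σ' '' Set.range f = (fun O => f '' O) '' Set.range (orb τ σ) := by
    rw [← Set.range_comp, ← Set.range_comp]
    congr 1
    ext1 x
    exact orb_map h' hf hσ hτ x
  rw [h1, finprod_mem_image hf.image_injective.injOn, wt]
  refine finprod_mem_congr rfl fun O _ => ?_
  unfold orbWt
  rw [Set.ncard_image_of_injective _ hf]
  congr 1
  simp only [Set.exists_mem_image, ← hτ, sameCycle_map_iff hf hσ]

/-- Functions of pairs `(τ, σ)` that are invariant under isomorphism and multiplicative on
disjoint unions. -/
structure IsMult {A : Type} [CommRing A] (Φ : ∀ α : Type, Perm α → Perm α → A) : Prop where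
  empty : ∀ (α : Type) [IsEmpty α] (τ σ : Perm α), Φ α τ σ = 1
  congr : ∀ {α β : Type} [Finite α] [Finite β] {τ σ : Perm α} {τ' σ' : Perm β}, IsSys τ σ →
    IsSys τ' σ' → ∀ e : α ≃ β, (∀ a, e (σ a) = σ' (e a)) → (∀ a, e (τ a) = τ' (e a)) →
      Φ α τ σ = Φ β τ' σ'
  sum : ∀ {α β : Type} [Finite α] [Finite β] {τ σ : Perm α} {τ' σ' : Perm β}, IsSys τ σ →
    IsSys τ' σ' → Φ (α ⊕ β) (Perm.sumCongr τ τ') (Perm.sumCongr σ σ') = Φ α τ σ * Φ β τ' σ'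

theorem IsSys.sumCongr {α β : Type} {τ σ : Perm α} {τ' σ' : Perm β} (h : IsSys τ σ)
    (h' : IsSys τ' σ') : IsSys (Perm.sumCongr τ τ') (Perm.sumCongr σ σ') where
  invol := by rintro (x | x) <;> simp [h.invol, h'.invol]
  ne := by rintro (x | x) <;> simp [h.ne, h'.ne]
  comm := by
    ext (x | x) <;> simp [h.apply_comm, h'.apply_comm]

theorem isMult_wt {A : Type} [CommRing A] (w : Bool → ℕ → A) :
    IsMult (fun _ τ σ => wt w τ σ) where
  empty α _ τ σ := by simp [wt, Set.range_eq_empty]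
  congr {α β _ _ τ σ τ' σ'} h h' e hσ hτ := by
    rw [← finprod_orb_map w h' e.injective hσ hτ, e.surjective.range_eq, Set.image_univ, wt]
  sum {α β _ _ τ σ τ' σ'} h h' := by
    have hs := h.sumCongr h'
    have h1 := finprod_orb_map w hs (τ := τ) (σ := σ) Sum.inl_injective (fun a => rfl)
      (fun a => rfl)
    have h2 := finprod_orb_map w hs (τ := τ') (σ := σ') Sum.inr_injective (fun a => rfl)
      (fun a => rfl)
    rw [← h1, ← h2, ← finprod_mem_union, ← Set.image_union, Set.range_inl_union_range_inr,
      Set.image_univ, wt]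
    · rw [Set.disjoint_left]
      rintro _ ⟨_, ⟨a, rfl⟩, rfl⟩ ⟨_, ⟨b, rfl⟩, heq⟩
      rw [orb_map hs (τ := τ) (σ := σ) Sum.inl_injective (fun a => rfl) (fun a => rfl),
        orb_map hs (τ := τ') (σ := σ') Sum.inr_injective (fun a => rfl) (fun a => rfl)] at heq
      have : Sum.inr b ∈ Sum.inl '' orb τ σ a := by
        rw [← heq]
        exact ⟨b, Or.inl (Perm.SameCycle.refl _ _), rfl⟩
      obtain ⟨c, _, hc⟩ := this
      exact Sum.inl_ne_inr hc
    · exact Set.toFinite _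
    · exact Set.toFinite _

/-- Minimal factorizations of `σ` with factors commuting with `τ`. -/
def facts {α : Type} (τ σ : Perm α) : Set (Perm α × Perm α) :=
  {pr | pr.1 * pr.2 = σ ∧ IsMinFact pr.1 pr.2 ∧ Commute pr.1 τ}

/-- Convolution over minimal factorizations. -/
noncomputable def star {A : Type} [CommRing A] {α : Type} (Φ Ψ : Perm α → A) (τ σ : Perm α) : A :=
  ∑ᶠ pr ∈ facts τ σ, Φ pr.1 * Ψ pr.2

theorem IsSys.of_facts {α : Type} {τ σ : Perm α} (h : IsSys τ σ) {pr : Perm α × Perm α}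
    (hp : pr ∈ facts τ σ) : IsSys τ pr.1 ∧ IsSys τ pr.2 := by
  obtain ⟨h1, -, h3⟩ := hp
  refine ⟨⟨h.invol, h.ne, h3⟩, h.invol, h.ne, ?_⟩
  have : pr.2 = pr.1⁻¹ * σ := by rw [← h1, inv_mul_cancel_left]
  rw [this]
  exact h3.inv_left.mul_left h.comm

theorem finsum_mem_mul_finsum_mem {A ι κ : Type} [CommRing A] [Finite ι] [Finite κ] (s : Set ι)
    (t : Set κ) (f : ι → A) (g : κ → A) :
    (∑ᶠ i ∈ s, f i) * (∑ᶠ j ∈ t, g j) = ∑ᶠ p ∈ s ×ˢ t, f p.1 * g p.2 := by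
  rw [finsum_mem_eq_finite_toFinset_sum _ (Set.toFinite s),
    finsum_mem_eq_finite_toFinset_sum _ (Set.toFinite t),
    finsum_mem_eq_finite_toFinset_sum _ (Set.toFinite (s ×ˢ t)), Finset.sum_mul_sum,
    ← Finset.sum_product']
  refine Finset.sum_congr ?_ fun _ _ => rfl
  ext
  simp

theorem star_eq_sum {A : Type} [CommRing A] {α : Type} [Fintype α] (Φ Ψ : Perm α → A)
    (τ σ : Perm α) :
    star Φ Ψ τ σ = ∑ P : Perm α, if IsMinFact P (P⁻¹ * σ) ∧ Commute P τ then
      Φ P * Ψ (P⁻¹ * σ) else 0 := by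
  rw [← Finset.sum_filter]
  rw [← finsum_mem_coe_finset]
  symm
  refine finsum_mem_eq_of_bijOn (fun P => (P, P⁻¹ * σ)) ⟨?_, ?_, ?_⟩ (fun _ _ => rfl)
  · intro P hP
    simp only [Finset.coe_filter, Finset.mem_univ, true_and] at hP
    exact ⟨mul_inv_cancel_left _ _, hP⟩
  · intro P _ P' _ h
    exact congrArg Prod.fst h
  · rintro ⟨P, R⟩ ⟨h1, h2, h3⟩
    have : P⁻¹ * σ = R := by rw [← h1, inv_mul_cancel_left]
    refine ⟨P, ?_, by simp only [this]⟩
    simp only [Finset.coe_filter, Finset.mem_univ, true_and]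
    exact ⟨this ▸ h2, h3⟩

theorem star_assoc {A : Type} [CommRing A] {α : Type} [Finite α] (Φ Ψ Χ : Perm α → A)
    (τ σ : Perm α) :
    star (fun ρ => star Φ Ψ τ ρ) Χ τ σ = star Φ (fun ρ => star Ψ Χ τ ρ) τ σ := by
  have := Fintype.ofFinite α
  simp only [star_eq_sum, Finset.sum_mul, Finset.mul_sum, ite_mul, mul_ite, zero_mul, mul_zero]
  have hl : ∀ Q : Perm α, (if IsMinFact Q (Q⁻¹ * σ) ∧ Commute Q τ then
      ∑ P : Perm α, (if IsMinFact P (P⁻¹ * Q) ∧ Commute P τ then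
        Φ P * Ψ (P⁻¹ * Q) * Χ (Q⁻¹ * σ) else 0) else 0) =
      ∑ P : Perm α, if (IsMinFact Q (Q⁻¹ * σ) ∧ Commute Q τ) ∧
        (IsMinFact P (P⁻¹ * Q) ∧ Commute P τ) then
        Φ P * Ψ (P⁻¹ * Q) * Χ (Q⁻¹ * σ) else 0 := by
    intro Q
    split_ifs with h <;> simp [h]
  have hr : ∀ P : Perm α, (if IsMinFact P (P⁻¹ * σ) ∧ Commute P τ then
      ∑ R : Perm α, (if IsMinFact R (R⁻¹ * (P⁻¹ * σ)) ∧ Commute R τ then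
        Φ P * (Ψ R * Χ (R⁻¹ * (P⁻¹ * σ))) else 0) else 0) =
      ∑ R : Perm α, if (IsMinFact P (P⁻¹ * σ) ∧ Commute P τ) ∧
        (IsMinFact R (R⁻¹ * (P⁻¹ * σ)) ∧ Commute R τ) then
        Φ P * (Ψ R * Χ (R⁻¹ * (P⁻¹ * σ))) else 0 := by
    intro Q
    split_ifs with h <;> simp [h]
  simp only [hl, hr]
  rw [Finset.sum_comm]
  refine Finset.sum_congr rfl fun P _ => ?_
  refine (Fintype.sum_equiv (Equiv.mulLeft P) _ _ fun R => ?_).symm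
  have h0 := isMinFact_triple P R (R⁻¹ * (P⁻¹ * σ))
  rw [mul_inv_cancel_left] at h0
  have h1 : Commute P τ → (Commute (P * R) τ ↔ Commute R τ) := by
    intro hP
    refine ⟨fun h => ?_, fun h => hP.mul_left h⟩
    simpa using hP.inv_left.mul_left h
  simp only [Equiv.coe_mulLeft, inv_mul_cancel_left, mul_inv_rev, mul_assoc]
  refine if_congr ?_ rfl rfl
  tauto

/-- The convolution of two multiplicative functions. -/
noncomputable def conv {A : Type} [CommRing A] (w v : Bool → ℕ → A) {α : Type}
    (τ σ : Perm α) : A :=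
  star (wt w τ) (wt v τ) τ σ

theorem bijOn_facts_sumCongr {α β : Type} [Finite α] [Finite β] (τ σ : Perm α) (τ' σ' : Perm β) :
    Set.BijOn (fun q : (Perm α × Perm α) × (Perm β × Perm β) =>
        (Perm.sumCongr q.1.1 q.2.1, Perm.sumCongr q.1.2 q.2.2))
      (facts τ σ ×ˢ facts τ' σ') (facts (Perm.sumCongr τ τ') (Perm.sumCongr σ σ')) := by
  have hinj : ∀ (a a' : Perm α) (b b' : Perm β), Perm.sumCongr a b = Perm.sumCongr a' b' →
      a = a' ∧ b = b' := by
    intro a a' b b' h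
    have := Perm.sumCongrHom_injective (α := α) (β := β) (a₁ := (a, b)) (a₂ := (a', b')) h
    exact ⟨congrArg Prod.fst this, congrArg Prod.snd this⟩
  refine ⟨?_, ?_, ?_⟩
  · rintro ⟨⟨P, R⟩, ⟨P', R'⟩⟩ ⟨⟨h1, h2, h3⟩, ⟨h1', h2', h3'⟩⟩
    dsimp only at *
    refine ⟨by simp only [Perm.sumCongr_mul, h1, h1'], ?_, ?_⟩
    · unfold IsMinFact at *
      simp only [Perm.sumCongr_mul, numOrb_sumCongr, Nat.card_sum]
      omega
    · unfold Commute SemiconjBy at *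
      simp only [Perm.sumCongr_mul, h3, h3']
  · rintro ⟨⟨P, R⟩, ⟨P', R'⟩⟩ - ⟨⟨Q, S⟩, ⟨Q', S'⟩⟩ - h
    obtain ⟨rfl, rfl⟩ := hinj _ _ _ _ (congrArg Prod.fst h)
    obtain ⟨rfl, rfl⟩ := hinj _ _ _ _ (congrArg Prod.snd h)
    rfl
  · rintro ⟨P, R⟩ ⟨h1, h2, h3⟩
    dsimp only at *
    have h4 := h2.mem_iff (S := Set.range Sum.inl) (by
      rw [h1]
      rintro (x | x) <;> simp)
    obtain ⟨⟨P₁, P₂⟩, rfl⟩ := Perm.mem_sumCongrHom_range_of_perm_mapsTo_inl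
      (σ := P) (fun x hx => (h4.1 x).2 hx)
    obtain ⟨⟨R₁, R₂⟩, rfl⟩ := Perm.mem_sumCongrHom_range_of_perm_mapsTo_inl
      (σ := R) (fun x hx => (h4.2 x).2 hx)
    simp only [Perm.sumCongrHom_apply] at *
    rw [Perm.sumCongr_mul] at h1
    obtain ⟨h5, h6⟩ := hinj _ _ _ _ h1
    unfold Commute SemiconjBy at h3
    rw [Perm.sumCongr_mul, Perm.sumCongr_mul] at h3
    obtain ⟨h7, h8⟩ := hinj _ _ _ _ h3
    have h9 := numOrb_add_le P₁ R₁
    have h10 := numOrb_add_le P₂ R₂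
    unfold IsMinFact at h2
    simp only [Perm.sumCongr_mul, numOrb_sumCongr, Nat.card_sum] at h2
    exact ⟨((P₁, R₁), (P₂, R₂)), ⟨⟨h5, by unfold IsMinFact; dsimp only; omega, h7⟩,
      ⟨h6, by unfold IsMinFact; dsimp only; omega, h8⟩⟩, rfl⟩

theorem bijOn_facts_permCongr {α β : Type} [Finite α] [Finite β] {τ σ : Perm α}
    {τ' σ' : Perm β} (e : α ≃ β) (hσ : ∀ a, e (σ a) = σ' (e a)) (hτ : ∀ a, e (τ a) = τ' (e a)) :
    Set.BijOn (fun q : Perm α × Perm α => (e.permCongrHom q.1, e.permCongrHom q.2))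
      (facts τ σ) (facts τ' σ') := by
  have h1 : e.permCongrHom σ = σ' := by
    ext b
    simp [permCongrHom, hσ]
  have h2 : e.permCongrHom τ = τ' := by
    ext b
    simp [permCongrHom, hτ]
  have h3 : ∀ P : Perm α, numOrb (e.permCongrHom P) = numOrb P := fun P =>
    (numOrb_congr e (fun a => by simp [permCongrHom])).symm
  have h4 : ∀ P R : Perm α, (e.permCongrHom P, e.permCongrHom R) ∈ facts τ' σ' ↔
      (P, R) ∈ facts τ σ := by
    intro P R
    simp only [facts, Set.mem_ofPred_eq, ← h1, ← h2, ← map_mul, EmbeddingLike.apply_eq_iff_eq,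
      IsMinFact, h3, Nat.card_congr e, Commute, SemiconjBy]
  refine ⟨fun q hq => (h4 q.1 q.2).2 hq, ?_, ?_⟩
  · intro q _ q' _ h
    exact Prod.ext (e.permCongrHom.injective (congrArg Prod.fst h))
      (e.permCongrHom.injective (congrArg Prod.snd h))
  · rintro ⟨P, R⟩ h
    obtain ⟨P, rfl⟩ := e.permCongrHom.surjective P
    obtain ⟨R, rfl⟩ := e.permCongrHom.surjective R
    exact ⟨(P, R), (h4 P R).1 h, rfl⟩

theorem facts_one {α : Type} (τ σ : Perm α) [IsEmpty α] : facts τ σ = {(1, 1)} := by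
  ext q
  constructor
  · intro _
    exact Subsingleton.elim _ _
  · rintro rfl
    refine ⟨Subsingleton.elim _ _, ?_, Commute.one_left _⟩
    simp [IsMinFact, numOrb_one]

theorem isMult_conv {A : Type} [CommRing A] (w v : Bool → ℕ → A) :
    IsMult (fun _ τ σ => conv w v τ σ) where
  empty α _ τ σ := by
    rw [conv, star, facts_one, finsum_mem_singleton, (isMult_wt w).empty, (isMult_wt v).empty,
      one_mul]
  congr {α β _ _ τ σ τ' σ'} h h' e hσ hτ := by
    refine finsum_mem_eq_of_bijOn _ (bijOn_facts_permCongr e hσ hτ) fun q hq => ?_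
    have h1 := h.of_facts hq
    have h2 := h'.of_facts ((bijOn_facts_permCongr e hσ hτ).1 hq)
    rw [(isMult_wt w).congr h1.1 h2.1 e (fun a => by simp [permCongrHom]) hτ,
      (isMult_wt v).congr h1.2 h2.2 e (fun a => by simp [permCongrHom]) hτ]
  sum {α β _ _ τ σ τ' σ'} h h' := by
    unfold conv star
    rw [finsum_mem_mul_finsum_mem]
    symm
    refine finsum_mem_eq_of_bijOn _ (bijOn_facts_sumCongr τ σ τ' σ') fun q hq => ?_
    have h1 := h.of_facts hq.1
    have h2 := h'.of_facts hq.2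
    rw [(isMult_wt w).sum h1.1 h2.1, (isMult_wt v).sum h1.2 h2.2]
    ring

theorem negMap_val {m : ℕ} (k : Fin (2 * m)) :
    (negMap m k : ℕ) = if k.val < m then k.val + m else k.val - m := by
  have := k.isLt
  simp only [negMap]
  split_ifs with h
  · exact Nat.mod_eq_of_lt (by omega)
  · rw [Nat.mod_eq_sub_mod (by omega), Nat.mod_eq_of_lt (by omega)]
    omega

theorem negMap_involutive (m : ℕ) : Function.Involutive (negMap m) := by
  intro k
  have := k.isLt
  apply Fin.ext
  rw [negMap_val, negMap_val]
  split_ifs <;> omega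

/-- Inversion as a permutation. -/
def negPerm (m : ℕ) : Perm (Fin (2 * m)) := (negMap_involutive m).toPerm

theorem negPerm_apply (m : ℕ) (k : Fin (2 * m)) : negPerm m k = negMap m k := rfl

theorem isSys_negPerm (m : ℕ) : IsSys (negPerm m) (finRotate (2 * m)) where
  invol := negMap_involutive m
  ne k h := by
    have h1 := congrArg Fin.val h
    have := k.isLt
    rw [negPerm_apply, negMap_val] at h1
    split_ifs at h1 <;> omega
  comm := by
    ext k
    have := k.isLt
    simp only [Perm.mul_apply, finRotate_val, negPerm_apply, negMap_val]
    split_ifs <;> omega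

theorem isSys_sumComm {α : Type} (σ : Perm α) :
    IsSys (Equiv.sumComm α α : Perm (α ⊕ α)) (Perm.sumCongr σ σ) where
  invol := by rintro (x | x) <;> rfl
  ne := by rintro (x | x) <;> simp
  comm := by
    ext (x | x) <;> rfl

theorem IsSys.sameCycle_iff {α : Type} [Finite α] {τ σ : Perm α} (h : IsSys τ σ) (x y : α) :
    σ.SameCycle (τ x) (τ y) ↔ σ.SameCycle x y :=
  sameCycle_map_iff τ.injective (fun a => (h.apply_comm a).symm) x y

theorem IsSys.exists_model {α : Type} [Finite α] {τ σ : Perm α} (h : IsSys τ σ) (x : α)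
    (hx : ∀ y, y ∈ orb τ σ x) :
    (∃ n, 0 < n ∧ ∃ e : Fin (2 * n) ≃ α, (∀ a, e (finRotate _ a) = σ (e a)) ∧
      ∀ a, e (negPerm n a) = τ (e a)) ∨
    ∃ n, 0 < n ∧ ∃ e : Fin n ⊕ Fin n ≃ α,
      (∀ a, e (Perm.sumCongr (finRotate n) (finRotate n) a) = σ (e a)) ∧
      ∀ a, e (Equiv.sumComm _ _ a) = τ (e a) := by
  set n := Function.minimalPeriod σ x with hn
  have hn0 : 0 < n := by
    refine Function.minimalPeriod_pos_of_mem_periodicPts ?_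
    exact Function.Injective.mem_periodicPts σ.injective x
  have hmod : ∀ k, σ^[k % n] x = σ^[k] x := fun k => Function.iterate_mod_minimalPeriod_eq
  have hinj : ∀ i < n, ∀ j < n, σ^[i] x = σ^[j] x → i = j := fun i hi j hj hij =>
    Function.iterate_injOn_Iio_minimalPeriod hi hj hij
  have hper : σ^[n] x = x := Function.iterate_minimalPeriod
  have hcyc : ∀ y, σ.SameCycle x y → ∃ i < n, σ^[i] x = y := by
    intro y hy
    obtain ⟨k, hk⟩ := hy.exists_nat_pow_eq
    exact ⟨k % n, Nat.mod_lt _ hn0, by rw [hmod, ← hk, Perm.iterate_eq_pow]⟩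
  have hτ : ∀ k y, σ^[k] (τ y) = τ (σ^[k] y) := by
    intro k y
    induction k with
    | zero => rfl
    | succ k ih => rw [Function.iterate_succ_apply', Function.iterate_succ_apply', ih, h.apply_comm]
  have hself : ∀ k, σ.SameCycle x (σ^[k] x) := fun k =>
    ⟨k, by rw [zpow_natCast, Perm.iterate_eq_pow]⟩
  by_cases hz : σ.SameCycle x (τ x)
  · left
    obtain ⟨j, hj, hjx⟩ := hcyc _ hz
    have h2 : σ^[2 * j] x = x := by
      rw [two_mul, Function.iterate_add_apply, hjx, hτ, hjx, h.invol]
    have hj0 : j ≠ 0 := by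
      rintro rfl
      exact h.ne x hjx.symm
    have hnj : n = 2 * j := by
      obtain ⟨c, hc⟩ := (Function.IsPeriodicPt.minimalPeriod_dvd h2 : n ∣ 2 * j)
      rw [← hn] at hc
      have : c < 2 := by
        by_contra hc2
        have : n * 2 ≤ n * c := Nat.mul_le_mul_left _ (by omega)
        omega
      interval_cases c <;> omega
    refine ⟨j, by omega, Equiv.ofBijective (fun i => σ^[i.val] x) ⟨?_, ?_⟩, ?_, ?_⟩
    · intro a b hab
      exact Fin.ext (hinj _ (by omega) _ (by omega) hab)
    · intro y
      have hy : σ.SameCycle x y := by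
        rcases hx y with hy | hy
        · exact hy
        · rw [← h.sameCycle_iff, h.invol] at hy
          exact hz.trans hy
      obtain ⟨i, hi, hiy⟩ := hcyc y hy
      exact ⟨⟨i, by omega⟩, hiy⟩
    · intro a
      show σ^[(finRotate (2 * j) a).val] x = σ (σ^[a.val] x)
      rw [finRotate_val]
      split_ifs with ha
      · rw [← Function.iterate_succ_apply' σ, Nat.succ_eq_add_one, ha, ← hnj, hper]
        rfl
      · rw [Function.iterate_succ_apply']
    · intro a
      show σ^[(a.val + j) % (2 * j)] x = τ (σ^[a.val] x)
      simp only [← hnj]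
      rw [hmod, Function.iterate_add_apply, hjx, hτ]
  · right
    have hcross : ∀ a b, σ^[a] x ≠ τ (σ^[b] x) := by
      intro a b hab
      apply hz
      have h1 := (h.sameCycle_iff _ _).2 (hself b)
      rw [← hab] at h1
      exact (hself a).trans h1.symm
    refine ⟨n, hn0, Equiv.ofBijective
      (Sum.elim (fun i => σ^[i.val] x) (fun i => τ (σ^[i.val] x))) ⟨?_, ?_⟩, ?_, ?_⟩
    · rintro (a | a) (b | b) hab
      · exact congrArg Sum.inl (Fin.ext (hinj _ a.isLt _ b.isLt hab))
      · exact absurd hab (hcross _ _)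
      · exact absurd hab.symm (hcross _ _)
      · exact congrArg Sum.inr (Fin.ext (hinj _ a.isLt _ b.isLt (τ.injective hab)))
    · intro y
      rcases hx y with hy | hy
      · obtain ⟨i, hi, hiy⟩ := hcyc y hy
        exact ⟨Sum.inl ⟨i, hi⟩, hiy⟩
      · obtain ⟨i, hi, hiy⟩ := hcyc _ hy
        exact ⟨Sum.inr ⟨i, hi⟩, by simp [hiy, h.invol]⟩
    · have key : ∀ a : Fin n, σ^[(finRotate n a).val] x = σ (σ^[a.val] x) := by
        intro a
        rw [finRotate_val]
        split_ifs with ha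
        · rw [← Function.iterate_succ_apply' σ, Nat.succ_eq_add_one, ha, hper]
          rfl
        · rw [Function.iterate_succ_apply']
      rintro (a | a)
      · exact key a
      · show τ (σ^[(finRotate n a).val] x) = σ (τ (σ^[a.val] x))
        rw [key, h.apply_comm]
    · rintro (a | a)
      · rfl
      · exact (h.invol _).symm

/-- A multiplicative function is determined by its values on single orbits. -/
theorem IsMult.ext {A : Type} [CommRing A] {Φ Ψ : ∀ α : Type, Perm α → Perm α → A}
    (hΦ : IsMult Φ) (hΨ : IsMult Ψ)
    (hz : ∀ n, 0 < n → Φ (Fin (2 * n)) (negPerm n) (finRotate _) =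
      Ψ (Fin (2 * n)) (negPerm n) (finRotate _))
    (hp : ∀ n, 0 < n →
      Φ (Fin n ⊕ Fin n) (Equiv.sumComm _ _) (Perm.sumCongr (finRotate n) (finRotate n)) =
      Ψ (Fin n ⊕ Fin n) (Equiv.sumComm _ _) (Perm.sumCongr (finRotate n) (finRotate n)))
    {α : Type} [Finite α] {τ σ : Perm α} (h : IsSys τ σ) : Φ α τ σ = Ψ α τ σ := by
  obtain ⟨N, hN⟩ : ∃ N, Nat.card α = N := ⟨_, rfl⟩
  induction N using Nat.strong_induction_on generalizing α with
  | _ N ih =>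
  rcases isEmpty_or_nonempty α with he | ⟨⟨x⟩⟩
  · rw [hΦ.empty, hΨ.empty]
  have hO1 : ∀ y, σ y ∈ orb τ σ x ↔ y ∈ orb τ σ x := by
    intro y
    simp only [orb, Set.mem_ofPred_eq, ← h.apply_comm, Perm.sameCycle_apply_right]
  have hO2 : ∀ y, τ y ∈ orb τ σ x ↔ y ∈ orb τ σ x := by
    intro y
    simp only [orb, Set.mem_ofPred_eq, h.invol]
    exact or_comm
  have hsub : ∀ (p : α → Prop) (h1 : ∀ y, p (σ y) ↔ p y) (h2 : ∀ y, p (τ y) ↔ p y),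
      IsSys (τ.subtypePerm h2) (σ.subtypePerm h1) := by
    intro p h1 h2
    refine ⟨fun y => Subtype.ext (h.invol _), fun y hy => h.ne y (congrArg Subtype.val hy), ?_⟩
    ext y
    exact h.apply_comm y
  have s1 := hsub (· ∈ orb τ σ x) hO1 hO2
  have s2 := hsub (· ∉ orb τ σ x) (fun y => not_congr (hO1 y)) (fun y => not_congr (hO2 y))
  have hcΦ := hΦ.congr (s1.sumCongr s2) h (Equiv.sumCompl (· ∈ orb τ σ x))
    (by rintro (a | a) <;> rfl) (by rintro (a | a) <;> rfl)
  have hcΨ := hΨ.congr (s1.sumCongr s2) h (Equiv.sumCompl (· ∈ orb τ σ x))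
    (by rintro (a | a) <;> rfl) (by rintro (a | a) <;> rfl)
  rw [hΦ.sum s1 s2] at hcΦ
  rw [hΨ.sum s1 s2] at hcΨ
  have hxO : x ∈ orb τ σ x := Or.inl (Perm.SameCycle.refl _ _)
  have h2 := ih (Nat.card {y // y ∉ orb τ σ x}) (by
    rw [← hN]
    exact Finite.card_subtype_lt (x := x) (by simpa using hxO)) s2 rfl
  rw [← hcΦ, ← hcΨ, h2]
  congr 1
  have htr : ∀ y, y ∈ orb (τ.subtypePerm hO2) (σ.subtypePerm hO1) ⟨x, hxO⟩ := by
    rintro ⟨y, hy⟩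
    have := orb_map h (τ := τ.subtypePerm hO2) (σ := σ.subtypePerm hO1)
      Subtype.val_injective (fun _ => rfl) (fun _ => rfl) ⟨x, hxO⟩
    rw [this] at hy
    obtain ⟨z, hz, rfl⟩ := hy
    exact hz
  rcases s1.exists_model _ htr with ⟨n, hn, e, he1, he2⟩ | ⟨n, hn, e, he1, he2⟩
  · rw [← hΦ.congr (isSys_negPerm n) s1 e he1 he2, ← hΨ.congr (isSys_negPerm n) s1 e he1 he2,
      hz n hn]
  · rw [← hΦ.congr (isSys_sumComm _) s1 e he1 he2, ← hΨ.congr (isSys_sumComm _) s1 e he1 he2,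
      hp n hn]

theorem wt_of_transitive {A : Type} [CommRing A] (w : Bool → ℕ → A) {α : Type} {τ σ : Perm α}
    (x : α) (hx : ∀ y z, z ∈ orb τ σ y) : wt w τ σ = orbWt w τ σ Set.univ := by
  have : Set.range (orb τ σ) = {Set.univ} := by
    have h1 : orb τ σ = fun _ => Set.univ := by
      ext y z
      simp [hx]
    have : Nonempty α := ⟨x⟩
    rw [h1, Set.range_const]
  rw [wt, this, finprod_mem_singleton]

theorem wt_negPerm {A : Type} [CommRing A] (w : Bool → ℕ → A) {n : ℕ} (hn : 0 < n) :
    wt w (negPerm n) (finRotate _) = w true n := by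
  rw [wt_of_transitive w ⟨0, by omega⟩ fun y z => Or.inl (finRotate_sameCycle y z), orbWt,
    if_pos ⟨⟨0, by omega⟩, trivial, finRotate_sameCycle _ _⟩, Set.ncard_univ, Nat.card_fin,
    Nat.mul_div_cancel_left _ (by omega)]

theorem sameCycle_sumCongr_inl {α β : Type} [Finite α] [Finite β] (σ : Perm α) (σ' : Perm β)
    (x y : α) : (Perm.sumCongr σ σ').SameCycle (Sum.inl x) (Sum.inl y) ↔ σ.SameCycle x y :=
  sameCycle_map_iff Sum.inl_injective (fun _ => rfl) x y

theorem sameCycle_sumCongr_inr {α β : Type} [Finite α] [Finite β] (σ : Perm α) (σ' : Perm β)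
    (x y : β) : (Perm.sumCongr σ σ').SameCycle (Sum.inr x) (Sum.inr y) ↔ σ'.SameCycle x y :=
  sameCycle_map_iff Sum.inr_injective (fun _ => rfl) x y

theorem not_sameCycle_sumCongr {α β : Type} [Finite α] [Finite β] (σ : Perm α) (σ' : Perm β)
    (x : α) (y : β) : ¬ (Perm.sumCongr σ σ').SameCycle (Sum.inl x) (Sum.inr y) := by
  intro h
  obtain ⟨z, hz⟩ := mem_of_sameCycle (U := Set.range Sum.inl)
    (by rintro _ ⟨a, rfl⟩; exact ⟨σ a, rfl⟩) h ⟨x, rfl⟩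
  exact Sum.inl_ne_inr hz

theorem not_sameCycle_sumComm {α : Type} [Finite α] (σ : Perm α) (x : α ⊕ α) :
    ¬ (Perm.sumCongr σ σ).SameCycle x (Equiv.sumComm _ _ x) := by
  rcases x with x | x
  · exact not_sameCycle_sumCongr _ _ _ _
  · exact fun h => not_sameCycle_sumCongr _ _ _ _ h.symm

theorem wt_sumComm {A : Type} [CommRing A] (w : Bool → ℕ → A) {α : Type} [Finite α]
    (σ : Perm α) : wt w (Equiv.sumComm α α : Perm (α ⊕ α)) (Perm.sumCongr σ σ) =
      ∏ᶠ X ∈ orbs σ, w false X.ncard := by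
  have h1 : ∀ x, orb (Equiv.sumComm α α) (Perm.sumCongr σ σ) (Sum.inl x) =
      Sum.inl '' {y | σ.SameCycle x y} ∪ Sum.inr '' {y | σ.SameCycle x y} := by
    intro x
    ext (y | y)
    · simp [orb, sameCycle_sumCongr_inl, not_sameCycle_sumCongr]
    · simp [orb, sameCycle_sumCongr_inl, not_sameCycle_sumCongr]
  have h2 : ∀ x, orb (Equiv.sumComm α α) (Perm.sumCongr σ σ) (Sum.inr x) =
      Sum.inl '' {y | σ.SameCycle x y} ∪ Sum.inr '' {y | σ.SameCycle x y} := by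
    intro x
    have h3 : ∀ y, ¬ (Perm.sumCongr σ σ).SameCycle (Sum.inr x) (Sum.inl y) := fun y h =>
      not_sameCycle_sumCongr _ _ _ _ h.symm
    ext (y | y)
    · simp [orb, sameCycle_sumCongr_inr, h3]
    · simp [orb, sameCycle_sumCongr_inr, h3]
  symm
  refine finprod_mem_eq_of_bijOn (fun X => Sum.inl '' X ∪ Sum.inr '' X) ⟨?_, ?_, ?_⟩ ?_
  · rintro _ ⟨x, rfl⟩
    exact ⟨Sum.inl x, h1 x⟩
  · intro X _ Y _ hXY
    have := congrArg (fun S => Sum.inl ⁻¹' S) hXY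
    simpa [Set.preimage_union, Set.preimage_image_eq _ Sum.inl_injective] using this
  · rintro _ ⟨x | x, rfl⟩
    · exact ⟨_, ⟨x, rfl⟩, (h1 x).symm⟩
    · exact ⟨_, ⟨x, rfl⟩, (h2 x).symm⟩
  · intro X _
    rw [orbWt, if_neg fun ⟨x, _, hx⟩ => not_sameCycle_sumComm σ x hx, Set.ncard_union_eq,
      Set.ncard_image_of_injective _ Sum.inl_injective,
      Set.ncard_image_of_injective _ Sum.inr_injective]
    · congr 1
      omega
    · rw [Set.disjoint_left]
      rintro _ ⟨a, _, rfl⟩ ⟨b, _, hb⟩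
      exact Sum.inl_ne_inr hb.symm

theorem wt_sumComm_finRotate {A : Type} [CommRing A] (w : Bool → ℕ → A) {n : ℕ} (hn : 0 < n) :
    wt w (Equiv.sumComm (Fin n) (Fin n)) (Perm.sumCongr (finRotate n) (finRotate n)) =
      w false n := by
  rw [wt_sumComm]
  have : orbs (finRotate n) = {Set.univ} := by
    have : Nonempty (Fin n) := ⟨⟨0, hn⟩⟩
    have h1 : (fun x : Fin n => {y | (finRotate n).SameCycle x y}) = fun _ => Set.univ := by
      ext x y
      simp [finRotate_sameCycle]
    rw [orbs, classes, h1, Set.range_const]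
  rw [this, finprod_mem_singleton, Set.ncard_univ, Nat.card_fin]

/-- A convolution of multiplicative functions is the multiplicative function attached to its
values on single orbits. -/
theorem conv_eq_wt {A : Type} [CommRing A] {w v u : Bool → ℕ → A}
    (hz : ∀ n, 0 < n → u true n = conv w v (negPerm n) (finRotate _))
    (hp : ∀ n, 0 < n → u false n =
      conv w v (Equiv.sumComm (Fin n) (Fin n)) (Perm.sumCongr (finRotate n) (finRotate n)))
    {α : Type} [Finite α] {τ σ : Perm α} (h : IsSys τ σ) : conv w v τ σ = wt u τ σ := by
  refine IsMult.ext (isMult_conv w v) (isMult_wt u) (fun n hn => ?_) (fun n hn => ?_) h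
  · rw [wt_negPerm u hn, hz n hn]
  · rw [wt_sumComm_finRotate u hn, hp n hn]

theorem bijOn_facts_sumComm {n : ℕ} :
    Set.BijOn (fun pr : Perm (Fin n) × Perm (Fin n) =>
        (Perm.sumCongr pr.1 pr.1, Perm.sumCongr pr.2 pr.2))
      {pr | pr.1 * pr.2 = finRotate n ∧ IsMinFact pr.1 pr.2}
      (facts (Equiv.sumComm _ _) (Perm.sumCongr (finRotate n) (finRotate n))) := by
  have hinj : ∀ (a a' : Perm (Fin n)) (b b' : Perm (Fin n)),
      Perm.sumCongr a b = Perm.sumCongr a' b' → a = a' ∧ b = b' := by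
    intro a a' b b' h
    have := Perm.sumCongrHom_injective (a₁ := (a, b)) (a₂ := (a', b')) h
    exact ⟨congrArg Prod.fst this, congrArg Prod.snd this⟩
  have hb := bijOn_facts_sumCongr (1 : Perm (Fin n)) (finRotate n) (1 : Perm (Fin n))
    (finRotate n)
  have hswap : ∀ P P' : Perm (Fin n),
      Commute (Perm.sumCongr P P') (Equiv.sumComm _ _ : Perm (Fin n ⊕ Fin n)) ↔ P = P' := by
    intro P P'
    constructor
    · intro h
      ext1 x
      have h1 := DFunLike.congr_fun h (Sum.inr x)
      exact Sum.inl_injective h1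
    · rintro rfl
      exact (isSys_sumComm P).comm
  refine ⟨?_, ?_, ?_⟩
  · rintro ⟨P, R⟩ ⟨h1, h2⟩
    have h3 := hb.1 (x := ((P, R), (P, R)))
      ⟨⟨h1, h2, Commute.one_right _⟩, ⟨h1, h2, Commute.one_right _⟩⟩
    exact ⟨h3.1, h3.2.1, (hswap _ _).2 rfl⟩
  · rintro ⟨P, R⟩ - ⟨P', R'⟩ - h
    exact Prod.ext (hinj _ _ _ _ (congrArg Prod.fst h)).1 (hinj _ _ _ _ (congrArg Prod.snd h)).1
  · rintro ⟨Q, S⟩ ⟨h1, h2, h3⟩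
    obtain ⟨⟨⟨P, R⟩, ⟨P', R'⟩⟩, ⟨⟨h4, h5, -⟩, ⟨h4', -⟩⟩, h6⟩ := hb.surjOn
      (show (Q, S) ∈ facts _ _ from ⟨h1, h2, by simp [Perm.sumCongr_one]⟩)
    obtain ⟨rfl, rfl⟩ := Prod.ext_iff.1 h6
    dsimp only at *
    obtain rfl := (hswap P P').1 h3
    obtain rfl : R = R' := mul_left_cancel (h4.trans h4'.symm)
    exact ⟨(P, R), ⟨h4, h5⟩, rfl⟩

theorem map_gammaFst {A : Type} [CommRing A] (φ : ℂ →+* A) (a b : ℕ → ℂ) (w v : Bool → ℕ → A)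
    (hw : ∀ j, w false j = φ (a j)) (hv : ∀ j, v false j = φ (b j)) {n : ℕ} (hn : 0 < n) :
    φ (gammaFst a b n) =
      conv w v (Equiv.sumComm (Fin n) (Fin n)) (Perm.sumCongr (finRotate n) (finRotate n)) := by
  have h1 : φ (gammaFst a b n) = ∑ᶠ pq ∈ {pq : Set (Set (Fin n)) × Set (Set (Fin n)) |
      NCPart pq.1 ∧ IsKr n pq.1 pq.2},
      φ ((∏ᶠ F ∈ pq.1, a F.ncard) * (∏ᶠ E ∈ pq.2, b E.ncard)) :=
    AddMonoidHom.map_finsum_mem _ φ.toAddMonoidHom (Set.toFinite _)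
  rw [h1, conv, star, ← finsum_mem_eq_of_bijOn _ bijOn_facts_sumComm (fun _ _ => rfl)]
  refine (finsum_mem_eq_of_bijOn _ (bijOn_orbs hn) fun pr _ => ?_).symm
  have h2 : ∀ (c : ℕ → ℂ) (p : Set (Set (Fin n))),
      φ (∏ᶠ F ∈ p, c F.ncard) = ∏ᶠ F ∈ p, φ (c F.ncard) := fun c p =>
    MonoidHom.map_finprod_mem _ φ.toMonoidHom (Set.toFinite _)
  simp only [wt_sumComm, hw, hv, map_mul, h2]

/-- The union of the zero-blocks. -/
def zeroSet {α : Type} (τ σ : Perm α) : Set α := {x | σ.SameCycle x (τ x)}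

theorem IsSys.apply_mem_zeroSet {α : Type} [Finite α] {τ σ : Perm α} (h : IsSys τ σ) (x : α) :
    τ x ∈ zeroSet τ σ ↔ x ∈ zeroSet τ σ :=
  h.sameCycle_iff x (τ x)

theorem IsSys.mem_zeroSet_of_sameCycle {α : Type} [Finite α] {τ σ : Perm α} (h : IsSys τ σ)
    {x y : α} (hxy : σ.SameCycle x y) (hx : x ∈ zeroSet τ σ) : y ∈ zeroSet τ σ :=
  (hxy.symm.trans hx).trans ((h.sameCycle_iff x y).2 hxy)

theorem neg_one_pow_numOrb {α : Type} [Finite α] {τ σ : Perm α} (h : IsSys τ σ) :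
    (-1 : ℤ) ^ numOrb σ = wt (fun b _ => if b then -1 else 1) τ σ := by
  refine IsMult.ext (Φ := fun _ _ σ => (-1 : ℤ) ^ numOrb σ) ⟨?_, ?_, ?_⟩ (isMult_wt _) ?_ ?_ h
  · intro α _ τ σ
    have : σ = 1 := Subsingleton.elim _ _
    simp [this, numOrb_one]
  · intro α β _ _ τ σ τ' σ' h h' e hσ hτ
    rw [numOrb_congr e hσ]
  · intro α β _ _ τ σ τ' σ' h h'
    rw [numOrb_sumCongr, pow_add]
  · intro n hn
    rw [wt_negPerm _ hn, numOrb_finRotate (by omega)]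
    simp
  · intro n hn
    rw [wt_sumComm_finRotate _ hn, numOrb_sumCongr, numOrb_finRotate hn]
    simp

theorem IsSys.even_numOrb {α : Type} [Finite α] {τ σ : Perm α} (h : IsSys τ σ)
    (h0 : zeroSet τ σ = ∅) : Even (numOrb σ) := by
  rw [← neg_one_pow_eq_one_iff_even (R := ℤ) (by norm_num), neg_one_pow_numOrb h, wt]
  refine finprod_mem_eq_one_of_forall_eq_one fun O _ => ?_
  rw [orbWt, if_neg]
  · simp
  · rintro ⟨x, _, hx⟩
    exact Set.eq_empty_iff_forall_notMem.1 h0 x hx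

theorem sameCycle_of_mem_zeroSet {m : ℕ} {P : Perm (Fin (2 * m))} (h : IsSys (negPerm m) P)
    (hP : NCPart (orbs P)) {x y : Fin (2 * m)} (hx : x ∈ zeroSet (negPerm m) P)
    (hy : y ∈ zeroSet (negPerm m) P) : P.SameCycle x y := by
  have hnc := (isNC_iff hP.1).1 hP.2
  simp only [sameBlock_orbs] at hnc
  have key : ∀ x y : Fin (2 * m), x.val < m → y.val < m → x < y →
      x ∈ zeroSet (negPerm m) P → y ∈ zeroSet (negPerm m) P → P.SameCycle x y := by
    intro x y hxm hym hxy hx hy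
    refine hnc x y _ _ hxy ?_ ?_ hx hy <;>
      simp only [Fin.lt_def, negPerm_apply, negMap_val] at * <;> split_ifs <;> omega
  have key2 : ∀ x y : Fin (2 * m), x.val < m → y.val < m →
      x ∈ zeroSet (negPerm m) P → y ∈ zeroSet (negPerm m) P → P.SameCycle x y := by
    intro x y hxm hym hx hy
    rcases lt_trichotomy x y with hxy | rfl | hxy
    · exact key x y hxm hym hxy hx hy
    · exact Perm.SameCycle.refl _ _
    · exact (key y x hym hxm hxy hy hx).symm
  have hsmall : ∀ x ∈ zeroSet (negPerm m) P, ∃ x' ∈ zeroSet (negPerm m) P,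
      x'.val < m ∧ P.SameCycle x x' := by
    intro x hx
    by_cases hxm : x.val < m
    · exact ⟨x, hx, hxm, Perm.SameCycle.refl _ _⟩
    · refine ⟨_, (h.apply_mem_zeroSet x).2 hx, ?_, hx⟩
      have := x.isLt
      rw [negPerm_apply, negMap_val, if_neg hxm]
      omega
  obtain ⟨x', hx', hxm, hxx⟩ := hsmall x hx
  obtain ⟨y', hy', hym, hyy⟩ := hsmall y hy
  exact (hxx.trans (key2 x' y' hxm hym hx' hy')).trans hyy.symm

theorem zeroSet_eq {m : ℕ} {P : Perm (Fin (2 * m))} (h : IsSys (negPerm m) P)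
    (hP : NCPart (orbs P)) {x : Fin (2 * m)} (hx : x ∈ zeroSet (negPerm m) P) :
    zeroSet (negPerm m) P = {y | P.SameCycle x y} := by
  ext y
  exact ⟨fun hy => sameCycle_of_mem_zeroSet h hP hx hy, fun hy => h.mem_zeroSet_of_sameCycle hy hx⟩

theorem isKr_of_facts {m : ℕ} (hm : 0 < m) {pr : Perm (Fin (2 * m)) × Perm (Fin (2 * m))}
    (h : pr ∈ facts (negPerm m) (finRotate _)) :
    NCPart (orbs pr.1) ∧ IsKr (2 * m) (orbs pr.1) (orbs pr.2) :=
  (bijOn_orbs (by omega)).1 ⟨h.1, h.2.1⟩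

theorem zeroSet_fst_or_snd {m : ℕ} (hm : 0 < m) {pr : Perm (Fin (2 * m)) × Perm (Fin (2 * m))}
    (h : pr ∈ facts (negPerm m) (finRotate _)) :
    (zeroSet (negPerm m) pr.1).Nonempty ∨ (zeroSet (negPerm m) pr.2).Nonempty := by
  obtain ⟨h1, h2⟩ := (isSys_negPerm m).of_facts h
  by_contra! hcon
  obtain ⟨a, ha⟩ := h1.even_numOrb hcon.1
  obtain ⟨b, hb⟩ := h2.even_numOrb hcon.2
  have h3 := h.2.1
  unfold IsMinFact at h3
  rw [h.1, numOrb_finRotate (by omega), Nat.card_fin] at h3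
  omega

theorem not_zeroSet_fst_and_snd {m : ℕ} {pr : Perm (Fin (2 * m)) × Perm (Fin (2 * m))}
    (h : pr ∈ facts (negPerm m) (finRotate _)) (hP : (zeroSet (negPerm m) pr.1).Nonempty)
    (hR : (zeroSet (negPerm m) pr.2).Nonempty) : False := by
  obtain ⟨h1, h2⟩ := (isSys_negPerm m).of_facts h
  have hsmall : ∀ Q, IsSys (negPerm m) Q → (zeroSet (negPerm m) Q).Nonempty →
      ∃ x ∈ zeroSet (negPerm m) Q, x.val < m := by
    rintro Q hQ ⟨x, hx⟩
    by_cases hxm : x.val < m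
    · exact ⟨x, hx, hxm⟩
    · refine ⟨_, (hQ.apply_mem_zeroSet x).2 hx, ?_⟩
      have := x.isLt
      rw [negPerm_apply, negMap_val, if_neg hxm]
      omega
  obtain ⟨x, hx, hxm⟩ := hsmall _ h1 hP
  obtain ⟨y, hy, hym⟩ := hsmall _ h2 hR
  have hk := ((h.2.1.isNCPerm h.1).sameCycle_iff_krRel h.1 _ _).1 hy x _ hx
  simp only [Fin.lt_def, negPerm_apply, negMap_val, if_pos hxm, if_pos hym] at hk
  omega

theorem negSet_cycle {m : ℕ} {P : Perm (Fin (2 * m))} (h : IsSys (negPerm m) P)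
    (x : Fin (2 * m)) : negSet m {y | P.SameCycle x y} = {y | P.SameCycle (negPerm m x) y} := by
  ext y
  constructor
  · rintro ⟨z, hz, rfl⟩
    exact (h.sameCycle_iff x z).2 hz
  · intro hy
    refine ⟨negPerm m y, ?_, h.invol y⟩
    have := (h.sameCycle_iff (negPerm m x) y).2 hy
    rwa [h.invol] at this

theorem negSet_cycle_eq_iff {m : ℕ} {P : Perm (Fin (2 * m))} (h : IsSys (negPerm m) P)
    (x : Fin (2 * m)) : negSet m {y | P.SameCycle x y} = {y | P.SameCycle x y} ↔
      x ∈ zeroSet (negPerm m) P := by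
  rw [negSet_cycle h]
  constructor
  · intro heq
    have : negPerm m x ∈ {y | P.SameCycle (negPerm m x) y} := Perm.SameCycle.refl _ _
    rwa [heq] at this
  · intro hx
    ext y
    exact ⟨fun hy => hx.trans hy, fun hy => hx.symm.trans hy⟩

/-- Commutation with inversion is equivalent to inversion-invariance of the partition. -/
theorem commute_negPerm_iff {m : ℕ} {P R : Perm (Fin (2 * m))} (hc : P * R = finRotate _)
    (hm : IsMinFact P R) : Commute P (negPerm m) ↔ ∀ B ∈ orbs P, negSet m B ∈ orbs P := by
  have s := isSys_negPerm m
  constructor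
  · intro h
    rintro _ ⟨x, rfl⟩
    exact ⟨negPerm m x, (negSet_cycle ⟨s.invol, s.ne, h⟩ x).symm⟩
  · intro h
    set τ := negPerm m with hτ
    have hinv : τ⁻¹ = τ := by
      ext1 x
      rw [Perm.inv_eq_iff_eq, s.invol]
    have hn : ∀ Q : Perm (Fin (2 * m)), numOrb (τ * Q * τ⁻¹) = numOrb Q := fun Q =>
      (numOrb_congr τ (fun a => by simp)).symm
    have hc' : (τ * P * τ⁻¹) * (τ * R * τ⁻¹) = finRotate _ := by
      have : (τ * P * τ⁻¹) * (τ * R * τ⁻¹) = τ * (P * R) * τ⁻¹ := by group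
      rw [this, hc, ← s.comm.eq, mul_inv_cancel_right]
    have hm' : IsMinFact (τ * P * τ⁻¹) (τ * R * τ⁻¹) := by
      unfold IsMinFact at *
      rwa [hc', hn, hn, ← hc]
    have hs : ∀ x y, P.SameCycle x y → P.SameCycle (τ x) (τ y) := by
      intro x y hxy
      rw [← sameBlock_orbs] at hxy ⊢
      obtain ⟨B, hB, hx, hy⟩ := hxy
      exact ⟨_, h B hB, ⟨x, hx, rfl⟩, ⟨y, hy, rfl⟩⟩
    have heq : P = τ * P * τ⁻¹ := by
      refine (hm.isNCPerm hc).eq_of_sameCycle (hm'.isNCPerm hc') fun x y => ?_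
      rw [Perm.sameCycle_conj, hinv]
      refine ⟨hs x y, fun hxy => ?_⟩
      have := hs _ _ hxy
      rwa [s.invol, s.invol] at this
    exact eq_mul_inv_iff_mul_eq.1 heq

/-- The chosen representatives of the pairs of non-zero-blocks. -/
def reps (m : ℕ) (p : Set (Set (Fin (2 * m)))) : Set (Set (Fin (2 * m))) :=
  {X | X ∈ p ∧ negSet m X ≠ X ∧ IsRep m X}

theorem orb_eq_union {m : ℕ} {P : Perm (Fin (2 * m))} (h : IsSys (negPerm m) P)
    (x : Fin (2 * m)) : orb (negPerm m) P x =
      {y | P.SameCycle x y} ∪ negSet m {y | P.SameCycle x y} := by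
  ext y
  rw [negSet_cycle h]
  refine or_congr Iff.rfl ?_
  rw [← h.sameCycle_iff, h.invol]
  rfl

theorem IsSys.mem_zeroSet_iff_of_mem_orb {α : Type} [Finite α] {τ σ : Perm α} (h : IsSys τ σ)
    {x y : α} (hy : y ∈ orb τ σ x) : y ∈ zeroSet τ σ ↔ x ∈ zeroSet τ σ := by
  rcases hy with hy | hy
  · exact ⟨h.mem_zeroSet_of_sameCycle hy.symm, h.mem_zeroSet_of_sameCycle hy⟩
  · rw [← h.apply_mem_zeroSet y]
    exact ⟨h.mem_zeroSet_of_sameCycle hy.symm, h.mem_zeroSet_of_sameCycle hy⟩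

theorem IsSys.orb_eq_of_mem {α : Type} [Finite α] {τ σ : Perm α} (h : IsSys τ σ)
    {x y : α} (hy : y ∈ orb τ σ x) : orb τ σ y = orb τ σ x := by
  have h1 : ∀ a b, σ.SameCycle a b → ∀ z, z ∈ orb τ σ b → z ∈ orb τ σ a := by
    rintro a b hab z (hz | hz)
    · exact Or.inl (hab.trans hz)
    · exact Or.inr (hab.trans hz)
  have h2 : ∀ a z, z ∈ orb τ σ (τ a) ↔ z ∈ orb τ σ a := by
    intro a z
    have h3 : σ.SameCycle (τ a) z ↔ σ.SameCycle a (τ z) := by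
      rw [← h.sameCycle_iff, h.invol]
    have h4 := h.sameCycle_iff a z
    simp only [orb, Set.mem_ofPred_eq, h3, h4]
    exact or_comm
  ext z
  rcases hy with hy | hy
  · exact ⟨h1 _ _ hy z, h1 _ _ hy.symm z⟩
  · rw [← h2 y]
    exact ⟨h1 _ _ hy z, h1 _ _ hy.symm z⟩

theorem bijOn_reps {m : ℕ} {P : Perm (Fin (2 * m))} (h : IsSys (negPerm m) P) :
    Set.BijOn (fun X => X ∪ negSet m X) (reps m (orbs P))
      {O | O ∈ Set.range (orb (negPerm m) P) ∧ ¬ ∃ x ∈ O, P.SameCycle x (negPerm m x)} := by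
  refine ⟨?_, ?_, ?_⟩
  · rintro _ ⟨⟨x, rfl⟩, hX, -⟩
    refine ⟨⟨x, orb_eq_union h x⟩, ?_⟩
    rintro ⟨y, hy, hyz⟩
    replace hy : y ∈ orb (negPerm m) P x := (orb_eq_union h x).symm ▸ hy
    exact hX ((negSet_cycle_eq_iff h x).2 ((h.mem_zeroSet_iff_of_mem_orb hy).1 hyz))
  · rintro _ ⟨⟨x, rfl⟩, -, a, ha, hxa⟩ _ ⟨⟨y, rfl⟩, -, b, hb, hyb⟩ heq
    dsimp only at heq
    rw [heq] at ha
    obtain rfl := ha.unique hb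
    ext z
    have hxy : P.SameCycle x y := Perm.SameCycle.trans hxa (Perm.SameCycle.symm hyb)
    exact ⟨hxy.symm.trans, hxy.trans⟩
  · rintro _ ⟨⟨x, rfl⟩, hx⟩
    have hxO : x ∈ orb (negPerm m) P x := Or.inl (Perm.SameCycle.refl _ _)
    obtain ⟨l, hl, hmin⟩ := Set.exists_min_image (orb (negPerm m) P x) id (Set.toFinite _)
      ⟨x, hxO⟩
    have hlx := h.orb_eq_of_mem hl
    have hlu := orb_eq_union h l
    refine ⟨{y | P.SameCycle l y}, ⟨⟨l, rfl⟩, ?_, l, ?_, Perm.SameCycle.refl _ _⟩, ?_⟩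
    · intro heq
      exact hx ⟨l, hl, (negSet_cycle_eq_iff h l).1 heq⟩
    · rw [← hlu, hlx]
      exact ⟨hl, hmin⟩
    · exact hlu.symm.trans hlx

theorem ncard_union_negSet {m : ℕ} {P : Perm (Fin (2 * m))} (h : IsSys (negPerm m) P)
    {X : Set (Fin (2 * m))} (hX : X ∈ orbs P) (hne : negSet m X ≠ X) :
    (X ∪ negSet m X).ncard / 2 = X.ncard := by
  obtain ⟨x, rfl⟩ := hX
  rw [Set.ncard_union_eq, negSet, Set.ncard_image_of_injective _ (negMap_involutive m).injective]
  · omega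
  · rw [negSet_cycle h, Set.disjoint_left]
    intro y hy hy'
    exact hne ((negSet_cycle_eq_iff h x).2 (Perm.SameCycle.trans hy (Perm.SameCycle.symm hy')))

theorem finprod_reps {A : Type} [CommRing A] (w : Bool → ℕ → A) {m : ℕ}
    {P : Perm (Fin (2 * m))} (h : IsSys (negPerm m) P) :
    ∏ᶠ X ∈ reps m (orbs P), w false X.ncard =
      ∏ᶠ O ∈ {O | O ∈ Set.range (orb (negPerm m) P) ∧
        ¬ ∃ x ∈ O, P.SameCycle x (negPerm m x)}, orbWt w (negPerm m) P O := by
  refine finprod_mem_eq_of_bijOn _ (bijOn_reps h) fun X hX => ?_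
  rw [orbWt, if_neg ((bijOn_reps h).1 hX).2, ncard_union_negSet h hX.1 hX.2.1]

theorem wt_of_zeroSet_eq_empty {A : Type} [CommRing A] (w : Bool → ℕ → A) {m : ℕ}
    {P : Perm (Fin (2 * m))} (h : IsSys (negPerm m) P) (h0 : ¬ (zeroSet (negPerm m) P).Nonempty) :
    wt w (negPerm m) P = ∏ᶠ X ∈ reps m (orbs P), w false X.ncard := by
  rw [finprod_reps w h, wt]
  refine finprod_mem_congr (Set.ext fun O => ?_) fun _ _ => rfl
  exact ⟨fun hO => ⟨hO, fun ⟨x, _, hx⟩ => h0 ⟨x, hx⟩⟩, fun hO => hO.1⟩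

theorem wt_of_zeroSet_nonempty {A : Type} [CommRing A] (w : Bool → ℕ → A) {m : ℕ}
    {P : Perm (Fin (2 * m))} (h : IsSys (negPerm m) P) (hP : NCPart (orbs P))
    (h0 : (zeroSet (negPerm m) P).Nonempty) :
    wt w (negPerm m) P = (∏ᶠ X ∈ reps m (orbs P), w false X.ncard) *
      w true ((zeroSet (negPerm m) P).ncard / 2) := by
  obtain ⟨x, hx⟩ := h0
  have hz : orb (negPerm m) P x = zeroSet (negPerm m) P := by
    rw [orb_eq_union h, (negSet_cycle_eq_iff h x).2 hx, Set.union_self, zeroSet_eq h hP hx]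
  have hw : orbWt w (negPerm m) P (zeroSet (negPerm m) P) =
      w true ((zeroSet (negPerm m) P).ncard / 2) := by
    rw [orbWt, if_pos ⟨x, hx, hx⟩]
  rw [finprod_reps w h, ← hw, ← finprod_mem_singleton (a := zeroSet (negPerm m) P)
    (f := orbWt w (negPerm m) P), ← finprod_mem_union _ (Set.toFinite _) (Set.toFinite _), wt]
  · refine finprod_mem_congr ?_ fun _ _ => rfl
    ext O
    constructor
    · rintro ⟨y, rfl⟩
      by_cases hy : ∃ z ∈ orb (negPerm m) P y, P.SameCycle z (negPerm m z)
      · right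
        obtain ⟨z, hzy, hzz⟩ := hy
        rw [Set.mem_singleton_iff, ← hz]
        have h1 := h.orb_eq_of_mem hzy
        have h2 : z ∈ orb (negPerm m) P x := hz ▸ hzz
        rw [← h1, h.orb_eq_of_mem h2]
      · exact Or.inl ⟨⟨y, rfl⟩, hy⟩
    · rintro (hO | rfl)
      · exact hO.1
      · exact ⟨x, hz⟩
  · rw [Set.disjoint_singleton_right]
    exact fun hZ => hZ.2 ⟨x, hx, hx⟩

theorem zeroSet_mem_orbs {m : ℕ} {P : Perm (Fin (2 * m))} (h : IsSys (negPerm m) P)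
    (hP : NCPart (orbs P)) (h0 : (zeroSet (negPerm m) P).Nonempty) :
    zeroSet (negPerm m) P ∈ orbs P ∧
      negSet m (zeroSet (negPerm m) P) = zeroSet (negPerm m) P := by
  obtain ⟨x, hx⟩ := h0
  rw [zeroSet_eq h hP hx]
  exact ⟨⟨x, rfl⟩, (negSet_cycle_eq_iff h x).2 hx⟩

theorem eq_zeroSet {m : ℕ} {P : Perm (Fin (2 * m))} (h : IsSys (negPerm m) P)
    (hP : NCPart (orbs P)) {Z : Set (Fin (2 * m))} (hZ : Z ∈ orbs P) (hn : negSet m Z = Z) :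
    (zeroSet (negPerm m) P).Nonempty ∧ Z = zeroSet (negPerm m) P := by
  obtain ⟨x, rfl⟩ := hZ
  have hx := (negSet_cycle_eq_iff h x).1 hn
  exact ⟨⟨x, hx⟩, (zeroSet_eq h hP hx).symm⟩

theorem exists_facts {m : ℕ} (hm : 0 < m) {p q : Set (Set (Fin (2 * m)))} (hp : NCBPart m p)
    (hq : IsKr (2 * m) p q) :
    ∃ pr ∈ facts (negPerm m) (finRotate _), (orbs pr.1, orbs pr.2) = (p, q) := by
  obtain ⟨pr, ⟨h1, h2⟩, h3⟩ := (bijOn_orbs (n := 2 * m) (by omega)).surjOn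
    (show (p, q) ∈ {pq : Set (Set (Fin (2 * m))) × Set (Set (Fin (2 * m))) |
      NCPart pq.1 ∧ IsKr (2 * m) pq.1 pq.2} from ⟨hp.1, hq⟩)
  refine ⟨pr, ⟨h1, h2, (commute_negPerm_iff h1 h2).2 ?_⟩, h3⟩
  obtain ⟨rfl, rfl⟩ := Prod.ext_iff.1 h3
  exact hp.2

theorem ncbPart_of_facts {m : ℕ} (hm : 0 < m) {pr : Perm (Fin (2 * m)) × Perm (Fin (2 * m))}
    (h : pr ∈ facts (negPerm m) (finRotate _)) : NCBPart m (orbs pr.1) :=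
  ⟨(isKr_of_facts hm h).1, (commute_negPerm_iff h.1 h.2.1).1 h.2.2⟩

theorem bijOn_zeroSet_fst {m : ℕ} (hm : 0 < m) :
    Set.BijOn (fun pr : Perm (Fin (2 * m)) × Perm (Fin (2 * m)) =>
        ((orbs pr.1, orbs pr.2), zeroSet (negPerm m) pr.1))
      {pr | pr ∈ facts (negPerm m) (finRotate _) ∧ (zeroSet (negPerm m) pr.1).Nonempty}
      {t | NCBPart m t.1.1 ∧ IsKr (2 * m) t.1.1 t.1.2 ∧ t.2 ∈ t.1.1 ∧ negSet m t.2 = t.2} := by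
  refine ⟨?_, ?_, ?_⟩
  · rintro pr ⟨h, h0⟩
    have hk := isKr_of_facts hm h
    have hs := (isSys_negPerm m).of_facts h
    exact ⟨ncbPart_of_facts hm h, hk.2, zeroSet_mem_orbs hs.1 hk.1 h0⟩
  · rintro pr ⟨h, -⟩ pr' ⟨h', -⟩ heq
    exact (bijOn_orbs (by omega)).injOn ⟨h.1, h.2.1⟩ ⟨h'.1, h'.2.1⟩ (congrArg Prod.fst heq)
  · rintro ⟨⟨p, q⟩, Z⟩ ⟨hp, hq, hZ, hn⟩
    obtain ⟨pr, h, heq⟩ := exists_facts hm hp hq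
    obtain ⟨rfl, rfl⟩ := Prod.ext_iff.1 heq
    obtain ⟨h0, rfl⟩ := eq_zeroSet ((isSys_negPerm m).of_facts h).1 hp.1 hZ hn
    exact ⟨pr, ⟨h, h0⟩, rfl⟩

theorem bijOn_zeroSet_snd {m : ℕ} (hm : 0 < m) :
    Set.BijOn (fun pr : Perm (Fin (2 * m)) × Perm (Fin (2 * m)) =>
        ((orbs pr.1, orbs pr.2), zeroSet (negPerm m) pr.2))
      {pr | pr ∈ facts (negPerm m) (finRotate _) ∧ (zeroSet (negPerm m) pr.2).Nonempty}
      {t | NCBPart m t.1.1 ∧ (¬ ∃ Z ∈ t.1.1, negSet m Z = Z) ∧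
        IsKr (2 * m) t.1.1 t.1.2 ∧ t.2 ∈ t.1.2 ∧ negSet m t.2 = t.2} := by
  refine ⟨?_, ?_, ?_⟩
  · rintro pr ⟨h, h0⟩
    have hk := isKr_of_facts hm h
    have hs := (isSys_negPerm m).of_facts h
    refine ⟨ncbPart_of_facts hm h, ?_, hk.2, zeroSet_mem_orbs hs.2 hk.2.1 h0⟩
    rintro ⟨Z, hZ, hn⟩
    exact not_zeroSet_fst_and_snd h (eq_zeroSet hs.1 hk.1 hZ hn).1 h0
  · rintro pr ⟨h, -⟩ pr' ⟨h', -⟩ heq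
    exact (bijOn_orbs (by omega)).injOn ⟨h.1, h.2.1⟩ ⟨h'.1, h'.2.1⟩ (congrArg Prod.fst heq)
  · rintro ⟨⟨p, q⟩, Z⟩ ⟨hp, -, hq, hZ, hn⟩
    obtain ⟨pr, h, heq⟩ := exists_facts hm hp hq
    obtain ⟨rfl, rfl⟩ := Prod.ext_iff.1 heq
    obtain ⟨h0, rfl⟩ := eq_zeroSet ((isSys_negPerm m).of_facts h).2 hq.1 hZ hn
    exact ⟨pr, ⟨h, h0⟩, rfl⟩

open TrivSqZeroExt

/-- The weights attached to a series: first components for pairs of blocks, second components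
for zero-blocks. -/
noncomputable def serWt (f : ℕ → DualNumber ℂ) (b : Bool) (j : ℕ) : DualNumber ℂ :=
  if b then inr (f (j - 1)).snd else inl (f (j - 1)).fst

theorem inl_finprod_reps (a : ℕ → ℂ) {m : ℕ} (p : Set (Set (Fin (2 * m)))) :
    (inl (∏ᶠ X ∈ reps m p, a X.ncard) : DualNumber ℂ) = ∏ᶠ X ∈ reps m p, inl (a X.ncard) :=
  MonoidHom.map_finprod_mem _ (inlHom ℂ ℂ).toMonoidHom (Set.toFinite _)

theorem inr_finsum_mem {ι : Type} [Finite ι] (s : Set ι) (F : ι → ℂ) :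
    (inr (∑ᶠ t ∈ s, F t) : DualNumber ℂ) = ∑ᶠ t ∈ s, inr (F t) :=
  AddMonoidHom.map_finsum_mem _ (inrHom ℂ ℂ).toAddMonoidHom (Set.toFinite _)

theorem inr_gammaSnd (f g : ℕ → DualNumber ℂ) {m : ℕ} (hm : 0 < m) :
    (inr (gammaSnd (fun j => (f (j - 1)).fst) (fun j => (f (j - 1)).snd)
      (fun j => (g (j - 1)).fst) (fun j => (g (j - 1)).snd) m) : DualNumber ℂ) =
      conv (serWt f) (serWt g) (negPerm m) (finRotate _) := by
  have hu : facts (negPerm m) (finRotate _) =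
      {pr | pr ∈ facts (negPerm m) (finRotate _) ∧ (zeroSet (negPerm m) pr.1).Nonempty} ∪
      {pr | pr ∈ facts (negPerm m) (finRotate _) ∧ (zeroSet (negPerm m) pr.2).Nonempty} := by
    ext pr
    constructor
    · intro h
      exact (zeroSet_fst_or_snd hm h).imp (fun h0 => ⟨h, h0⟩) fun h0 => ⟨h, h0⟩
    · rintro (h | h) <;> exact h.1
  have hd : Disjoint
      {pr | pr ∈ facts (negPerm m) (finRotate _) ∧ (zeroSet (negPerm m) pr.1).Nonempty}
      {pr | pr ∈ facts (negPerm m) (finRotate _) ∧ (zeroSet (negPerm m) pr.2).Nonempty} := by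
    rw [Set.disjoint_left]
    rintro pr ⟨h, h0⟩ ⟨-, h0'⟩
    exact not_zeroSet_fst_and_snd h h0 h0'
  rw [conv, star, hu, finsum_mem_union hd (Set.toFinite _) (Set.toFinite _), gammaSnd, inr_add]
  refine congrArg₂ (· + ·) ((inr_finsum_mem _ _).trans ?_) ((inr_finsum_mem _ _).trans ?_)
  · refine (finsum_mem_eq_of_bijOn _ (bijOn_zeroSet_fst hm) ?_).symm
    rintro pr ⟨h, h0⟩
    have hk := isKr_of_facts hm h
    have hs := (isSys_negPerm m).of_facts h
    rw [wt_of_zeroSet_nonempty _ hs.1 hk.1 h0,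
      wt_of_zeroSet_eq_empty _ hs.2 fun h0' => not_zeroSet_fst_and_snd h h0 h0']
    simp only [serWt, if_true, Bool.false_eq_true, if_false]
    rw [← inl_finprod_reps (fun j => (f (j - 1)).fst),
      ← inl_finprod_reps (fun j => (g (j - 1)).fst),
      inl_mul_inr, inr_mul_inl]
    simp only [smul_eq_mul, MulOpposite.smul_eq_mul_unop, MulOpposite.unop_op]
    rfl
  · refine (finsum_mem_eq_of_bijOn _ (bijOn_zeroSet_snd hm) ?_).symm
    rintro pr ⟨h, h0⟩
    have hk := isKr_of_facts hm h
    have hs := (isSys_negPerm m).of_facts h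
    rw [wt_of_zeroSet_nonempty _ hs.2 hk.2.1 h0,
      wt_of_zeroSet_eq_empty _ hs.1 fun h0' => not_zeroSet_fst_and_snd h h0' h0]
    simp only [serWt, if_true, Bool.false_eq_true, if_false]
    rw [← inl_finprod_reps (fun j => (f (j - 1)).fst),
      ← inl_finprod_reps (fun j => (g (j - 1)).fst),
      inl_mul_inr, inl_mul_inr]
    congr 1
    simp only [smul_eq_mul, reps]
    ring

theorem inl_gammaFst (f g : ℕ → DualNumber ℂ) {n : ℕ} (hn : 0 < n) :
    (inl (gammaFst (fun j => (f (j - 1)).fst) (fun j => (g (j - 1)).fst) n) : DualNumber ℂ) =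
      conv (serWt f) (serWt g) (Equiv.sumComm (Fin n) (Fin n))
        (Perm.sumCongr (finRotate n) (finRotate n)) :=
  map_gammaFst (inlHom ℂ ℂ) _ _ (serWt f) (serWt g) (fun _ => rfl) (fun _ => rfl) hn

/-- The weights of a boxed convolution are given by convolution of multiplicative functions. -/
theorem conv_serWt (f g : ℕ → DualNumber ℂ) {α : Type} [Finite α] {τ σ : Perm α}
    (h : IsSys τ σ) : conv (serWt f) (serWt g) τ σ = wt (serWt (boxedB f g)) τ σ := by
  refine conv_eq_wt (fun n hn => ?_) (fun n hn => ?_) h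
  · rw [← inr_gammaSnd f g hn]
    simp [serWt, boxedB, mkD, Nat.sub_add_cancel hn]
  · rw [← inl_gammaFst f g hn]
    simp [serWt, boxedB, mkD, Nat.sub_add_cancel hn]

theorem serWt_ext {f g : ℕ → DualNumber ℂ} (h : ∀ (α : Type) [Finite α] (τ σ : Perm α),
    IsSys τ σ → wt (serWt f) τ σ = wt (serWt g) τ σ) : f = g := by
  ext1 k
  have h1 := h _ _ _ (isSys_negPerm (k + 1))
  have h2 := h _ _ _ (isSys_sumComm (finRotate (k + 1)))
  rw [wt_negPerm _ k.succ_pos, wt_negPerm _ k.succ_pos] at h1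
  rw [wt_sumComm_finRotate _ k.succ_pos, wt_sumComm_finRotate _ k.succ_pos] at h2
  simp only [serWt, if_true, Bool.false_eq_true, if_false] at h1 h2
  exact TrivSqZeroExt.ext (inl_injective h2) (inr_injective h1)

theorem wt_boxedB (f g : ℕ → DualNumber ℂ) {α : Type} [Finite α] {τ σ : Perm α}
    (h : IsSys τ σ) : wt (serWt (boxedB f g)) τ σ =
      star (wt (serWt f) τ) (wt (serWt g) τ) τ σ :=
  (conv_serWt f g h).symm

theorem finRotate_eq_one_iff {n : ℕ} : finRotate n = 1 ↔ n ≤ 1 := by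
  constructor
  · intro h
    by_contra! hn
    have h1 := finRotate_val (n := n) ⟨0, by omega⟩
    rw [h, if_neg (by simp only; omega)] at h1
    simp at h1
  · intro hn
    have : Subsingleton (Fin n) := Fin.subsingleton_iff_le_one.2 hn
    exact Subsingleton.elim _ _

theorem sumCongr_eq_one_iff {α β : Type} {σ : Perm α} {σ' : Perm β} :
    Perm.sumCongr σ σ' = 1 ↔ σ = 1 ∧ σ' = 1 := by
  have := map_eq_one_iff (Perm.sumCongrHom α β) Perm.sumCongrHom_injective (x := (σ, σ'))
  rwa [Perm.sumCongrHom_apply, Prod.mk_eq_one] at this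

theorem wt_deltaB {α : Type} [Finite α] {τ σ : Perm α} (h : IsSys τ σ) :
    wt (serWt deltaB) τ σ = if σ = 1 then 1 else 0 := by
  symm
  refine IsMult.ext (Φ := fun _ _ σ => if σ = 1 then (1 : DualNumber ℂ) else 0) ⟨?_, ?_, ?_⟩
    (isMult_wt _) ?_ ?_ h
  · intro α _ τ σ
    exact if_pos (Subsingleton.elim _ _)
  · intro α β _ _ τ σ τ' σ' h h' e hσ hτ
    refine if_congr ⟨?_, ?_⟩ rfl rfl
    · rintro rfl
      ext1 b
      simpa using (hσ (e.symm b)).symm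
    · rintro rfl
      ext1 a
      exact e.injective (hσ a)
  · intro α β _ _ τ σ τ' σ' h h'
    simp only [sumCongr_eq_one_iff]
    split_ifs <;> simp_all
  · intro n hn
    rw [wt_negPerm _ hn, if_neg (by rw [finRotate_eq_one_iff]; omega)]
    simp only [serWt, deltaB, if_true]
    split_ifs <;> simp
  · intro n hn
    simp only [wt_sumComm_finRotate _ hn, sumCongr_eq_one_iff, finRotate_eq_one_iff, serWt, deltaB,
      Bool.false_eq_true, if_false, and_self]
    by_cases h1 : n ≤ 1
    · simp [h1]
    · simp [h1, show n - 1 ≠ 0 by omega]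

theorem finsum_mem_ite_eq {A ι : Type} [CommRing A] [DecidableEq ι] {s : Set ι} {x : ι}
    (hx : x ∈ s) (a : A) :
    ∑ᶠ i ∈ s, (if i = x then a else 0) = a := by
  rw [finsum_mem_inter_support_eq' _ s {x}, finsum_mem_singleton, if_pos rfl]
  intro i hi
  rw [Function.mem_support, ne_eq, ite_eq_right_iff, Classical.not_imp] at hi
  simp [hi.1, hx]

theorem star_indicator_right {A : Type} [CommRing A] {α : Type} [Finite α] (Φ : Perm α → A)
    {Δ : Perm α → A} {τ σ : Perm α} (h : Commute σ τ)
    (hΔ : ∀ pr ∈ facts τ σ, Δ pr.2 = if pr.2 = 1 then 1 else 0) : star Φ Δ τ σ = Φ σ := by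
  have hmem : (σ, (1 : Perm α)) ∈ facts τ σ :=
    ⟨mul_one σ, by simp [IsMinFact, numOrb_one, add_comm], h⟩
  have h1 : ∀ pr ∈ facts τ σ, Φ pr.1 * Δ pr.2 = if pr = (σ, 1) then Φ σ else 0 := by
    rintro ⟨P, R⟩ hpr
    have hc : P * R = σ := hpr.1
    rw [hΔ _ hpr]
    by_cases hR : R = 1
    · subst hR
      rw [mul_one] at hc
      simp [hc]
    · simp [hR]
  rw [star, finsum_mem_congr rfl h1, finsum_mem_ite_eq hmem]

theorem star_indicator_left {A : Type} [CommRing A] {α : Type} [Finite α] (Φ : Perm α → A)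
    {Δ : Perm α → A} {τ σ : Perm α}
    (hΔ : ∀ pr ∈ facts τ σ, Δ pr.1 = if pr.1 = 1 then 1 else 0) : star Δ Φ τ σ = Φ σ := by
  have hmem : ((1 : Perm α), σ) ∈ facts τ σ :=
    ⟨one_mul σ, by simp [IsMinFact, numOrb_one], Commute.one_left _⟩
  have h1 : ∀ pr ∈ facts τ σ, Δ pr.1 * Φ pr.2 = if pr = (1, σ) then Φ σ else 0 := by
    rintro ⟨P, R⟩ hpr
    have hc : P * R = σ := hpr.1
    rw [hΔ _ hpr]
    by_cases hP : P = 1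
    · subst hP
      rw [one_mul] at hc
      simp [hc]
    · simp [hP]
  rw [star, finsum_mem_congr rfl h1, finsum_mem_ite_eq hmem]

theorem boxedB_assoc (f g h : ℕ → DualNumber ℂ) :
    boxedB (boxedB f g) h = boxedB f (boxedB g h) := by
  refine serWt_ext fun α _ τ σ hs => ?_
  rw [wt_boxedB _ _ hs, wt_boxedB _ _ hs]
  have h1 : star (wt (serWt (boxedB f g)) τ) (wt (serWt h) τ) τ σ =
      star (fun ρ => star (wt (serWt f) τ) (wt (serWt g) τ) τ ρ) (wt (serWt h) τ) τ σ :=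
    finsum_mem_congr rfl fun pr hpr => by rw [wt_boxedB _ _ (hs.of_facts hpr).1]
  have h2 : star (wt (serWt f) τ) (wt (serWt (boxedB g h)) τ) τ σ =
      star (wt (serWt f) τ) (fun ρ => star (wt (serWt g) τ) (wt (serWt h) τ) τ ρ) τ σ :=
    finsum_mem_congr rfl fun pr hpr => by rw [wt_boxedB _ _ (hs.of_facts hpr).2]
  rw [h1, h2, star_assoc]

theorem boxedB_deltaB (f : ℕ → DualNumber ℂ) : boxedB f deltaB = f :=
  serWt_ext fun α _ τ σ hs => by
    rw [wt_boxedB _ _ hs, star_indicator_right _ hs.comm fun pr hpr =>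
      wt_deltaB (hs.of_facts hpr).2]

theorem deltaB_boxedB (f : ℕ → DualNumber ℂ) : boxedB deltaB f = f :=
  serWt_ext fun α _ τ σ hs => by
    rw [wt_boxedB _ _ hs, star_indicator_left _ fun pr hpr => wt_deltaB (hs.of_facts hpr).1]

end NCPB

open NCPB in
/-- The boxed convolution of type B on `Θ^B` is associative, with the
series `Δ'(z) = (1,0)z` as a two-sided unit. -/
theorem boxedB_assoc_and_unit :
    (∀ f g h : ℕ → DualNumber ℂ, boxedB (boxedB f g) h = boxedB f (boxedB g h)) ∧
    (∀ f : ℕ → DualNumber ℂ, boxedB f deltaB = f ∧ boxedB deltaB f = f) := by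
  exact ⟨boxedB_assoc, fun f => ⟨boxedB_deltaB f, deltaB_boxedB f⟩⟩
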